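/- There exists a constant c > 0 with the following property. If m : ℕ → ℕ is a sequence such that ζ(n) := (2·m(n) − n)·n^{−2/3} satisfies ζ(n) > 0 for all n and ζ(n)/n^{1/12} → 0 as n → ∞, then for all sufficiently large n: |𝒰(n, m(n))| ≤ c · n^{−1/2} · (2/e)^{2m(n)−n} · m(n)^{m(n)+1/2} · n^{n−2m(n)+1/2} · (n−m(n))^{−(n−m(n)+1/2)} · C(C(n,2), m(n)). -/

import Mathlib

open Filter

/-- A graph has no complex component: for every connected component, the number of
edges joining two vertices of that component is at most the number of its vertices. -/
def NonComplex {n : ℕ} (G : SimpleGraph (Fin n)) : Prop :=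
  ∀ c : G.ConnectedComponent,
    {e : Sym2 (Fin n) | e ∈ G.edgeSet ∧ ∀ v ∈ e, v ∈ c.supp}.ncard ≤ c.supp.ncard

/-- `Ucard n m` is the number of simple graphs on `Fin n` with exactly `m` edges
in which no connected component is complex. -/
noncomputable def Ucard (n m : ℕ) : ℕ :=
  Nat.card {G : SimpleGraph (Fin n) // G.edgeSet.ncard = m ∧ NonComplex G}

open scoped Classical in
/-- number of ordered adjacent pairs inside `X` -/
noncomputable def e2 {V : Type} (G : SimpleGraph V) (X : Finset V) : ℕ :=
  ∑ u ∈ X, ∑ v ∈ X, if G.Adj u v then 1 else 0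

open scoped Classical in
/-- degree -/
noncomputable def dg {V : Type} [Fintype V] (G : SimpleGraph V) (u : V) : ℕ :=
  ∑ v, if G.Adj u v then 1 else 0

/-- add an edge -/
def addE {V : Type} (G : SimpleGraph V) (l w : V) (h : l ≠ w) : SimpleGraph V where
  Adj u v := G.Adj u v ∨ (u = l ∧ v = w) ∨ (u = w ∧ v = l)
  symm := ⟨by
    rintro u v (h | h | h)
    · exact Or.inl h.symm
    · exact Or.inr (Or.inr ⟨h.2, h.1⟩)
    · exact Or.inr (Or.inl ⟨h.2, h.1⟩)⟩
  loopless := ⟨by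
    rintro u (h1 | h1 | h1)
    · exact G.loopless.irrefl _ h1
    · exact h (h1.1.symm.trans h1.2)
    · exact h (h1.2.symm.trans h1.1)⟩

/-- remove the edges at vertices satisfying `P` -/
def remV {V : Type} (G : SimpleGraph V) (P : V → Prop) : SimpleGraph V where
  Adj u v := G.Adj u v ∧ ¬ P u ∧ ¬ P v
  symm := ⟨fun _ _ h => ⟨h.1.symm, h.2.2, h.2.1⟩⟩
  loopless := ⟨fun _ h => G.loopless.irrefl _ h.1⟩

lemma dg_eq_one {V : Type} [Fintype V] {G : SimpleGraph V} {u : V} :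
    dg G u = 1 ↔ ∃ w, G.Adj u w ∧ ∀ v, G.Adj u v → v = w := by
  classical
  rw [dg, ← Finset.card_filter, Finset.card_eq_one]
  constructor
  · rintro ⟨w, hw⟩
    refine ⟨w, ?_, fun v hv => ?_⟩
    · have : w ∈ ({w} : Finset V) := by simp
      rw [← hw] at this; simpa using this
    · have : v ∈ Finset.filter (fun v => G.Adj u v) Finset.univ := by simpa using hv
      rw [hw] at this; simpa using this
  · rintro ⟨w, h1, h2⟩
    refine ⟨w, ?_⟩
    ext v
    simp only [Finset.mem_filter, Finset.mem_univ, true_and, Finset.mem_singleton]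
    exact ⟨h2 v, fun h => h ▸ h1⟩

lemma dg_eq_zero {V : Type} [Fintype V] {G : SimpleGraph V} {u : V} :
    dg G u = 0 ↔ ∀ v, ¬ G.Adj u v := by
  classical
  rw [dg, ← Finset.card_filter, Finset.card_eq_zero, Finset.filter_eq_empty_iff]
  simp

lemma e2_univ {V : Type} [Fintype V] (G : SimpleGraph V) :
    e2 G Finset.univ = ∑ u, dg G u := rfl

lemma e2_le {V : Type} [Fintype V] (G : SimpleGraph V) (X : Finset V) :
    e2 G X ≤ ∑ u ∈ X, dg G u := by
  refine Finset.sum_le_sum fun u _ => ?_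
  exact Finset.sum_le_sum_of_subset (Finset.subset_univ _)

lemma e2_addE {V : Type} (G : SimpleGraph V) (l w : V) (h : l ≠ w)
    (hl : ¬ G.Adj l w) (X : Finset V) [DecidableEq V] :
    e2 (addE G l w h) X = e2 G X + if l ∈ X ∧ w ∈ X then 2 else 0 := by
  classical
  have key : ∀ u v, (if (addE G l w h).Adj u v then 1 else 0) =
      (if G.Adj u v then 1 else 0) + ((if u = l then (if v = w then 1 else 0) else 0)
        + (if u = w then (if v = l then 1 else 0) else 0)) := by
    intro u v
    have hl' : ¬ G.Adj w l := fun h => hl h.symm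
    have h' : w ≠ l := h.symm
    by_cases h1 : u = l <;> by_cases h2 : v = w <;> by_cases h3 : u = w <;> by_cases h4 : v = l <;>
      simp_all [addE]
  simp only [e2, key, Finset.sum_add_distrib]
  congr 1
  have : ∀ a b : V, (∑ u ∈ X, ∑ v ∈ X, if u = a then (if v = b then 1 else 0) else 0)
      = if a ∈ X ∧ b ∈ X then 1 else 0 := by
    intro a b
    have : ∀ u, (∑ v ∈ X, if u = a then (if v = b then 1 else 0) else 0)
       = if u = a then (if b ∈ X then 1 else 0) else 0 := by
      intro u; split_ifs <;> simp_all
    simp only [this, Finset.sum_ite_eq']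
    split_ifs <;> simp_all
  rw [this, this]
  split_ifs <;> simp_all

open scoped Classical in
/-- sparse graphs on the vertex subset `S` -/
noncomputable def PP {V : Type} [Fintype V] (r : ℕ) (S : Finset V) : Finset (SimpleGraph V) :=
  Finset.univ.filter fun G => (∀ u v, G.Adj u v → u ∈ S) ∧ (∀ X, e2 G X ≤ 2 * X.card) ∧
    e2 G Finset.univ + 2 * r = 2 * S.card

/-- `L` is an independent set of leaves -/
def Valid {V : Type} [Fintype V] (G : SimpleGraph V) (L : Finset V) : Prop :=
  ∀ l ∈ L, dg G l = 1 ∧ ∀ l' ∈ L, ¬ G.Adj l l'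

lemma valid_iff {V : Type} [Fintype V] (G : SimpleGraph V) (L : Finset V) :
    Valid G L ↔ ∀ l ∈ L, ∃ w, w ∉ L ∧ ∀ v, G.Adj l v ↔ v = w := by
  constructor
  · intro h l hl
    obtain ⟨h1, h2⟩ := h l hl
    obtain ⟨w, hw, hw'⟩ := dg_eq_one.1 h1
    exact ⟨w, fun h => h2 w h hw, fun v => ⟨hw' v, fun h => h ▸ hw⟩⟩
  · intro h l hl
    obtain ⟨w, hw, hw'⟩ := h l hl
    refine ⟨dg_eq_one.2 ⟨w, (hw' w).2 rfl, fun v hv => (hw' v).1 hv⟩, fun l' hl' hadj => ?_⟩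
    exact hw ((hw' l').1 hadj ▸ hl')

open scoped Classical in
lemma leaf_count {V : Type} [Fintype V] (r : ℕ) (S L : Finset V) (l : V) (hlL : l ∉ L)
    (hS : insert l L ⊆ S) :
    ((PP r S).filter fun G => Valid G (insert l L)).card =
      (S \ insert l L).card * ((PP r (S.erase l)).filter fun G => Valid G L).card := by
  symm
  rw [← Finset.card_product]
  have hlS : l ∈ S := hS (by simp)
  have hne : ∀ a : V × SimpleGraph V,
    a ∈ (S \ insert l L) ×ˢ ((PP r (S.erase l)).filter fun G => Valid G L) → l ≠ a.1 := by
    rintro ⟨w, G⟩ ha h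
    simp only [Finset.mem_product, Finset.mem_sdiff, Finset.mem_insert] at ha
    exact ha.1.2 (Or.inl h.symm)
  have hiso : ∀ G : SimpleGraph V, (∀ u v, G.Adj u v → u ∈ S.erase l) → ∀ v, ¬ G.Adj l v ∧ ¬ G.Adj v l := by
    intro G hG v
    have h1 : ¬ G.Adj l v := fun h => by simpa using hG _ _ h
    exact ⟨h1, fun h => h1 h.symm⟩
  have hcard : (S.erase l).card + 1 = S.card := Finset.card_erase_add_one hlS
  refine Finset.card_bij (fun a ha => addE a.2 l a.1 (hne a ha)) ?_ ?_ ?_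
  · rintro ⟨w, G⟩ ha
    have hlw := hne _ ha
    simp only [Finset.mem_product, Finset.mem_sdiff, Finset.mem_insert, Finset.mem_filter, PP,
      Finset.mem_univ, true_and, not_or] at ha hlw ⊢
    obtain ⟨⟨hwS, hwl, hwL⟩, ⟨hG1, hG2, hG3⟩, hG4⟩ := ha
    have hi := hiso G hG1
    refine ⟨⟨?_, ?_, ?_⟩, ?_⟩
    · rintro u v (h | h | h)
      · exact Finset.mem_of_mem_erase (hG1 u v h)
      · rw [h.1]; exact hlS
      · rw [h.1]; exact hwS
    · intro X
      rw [e2_addE _ _ _ _ (hi w).1]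
      split_ifs with h
      · have h1 := hG2 (X.erase l)
        have h2 : e2 G X = e2 G (X.erase l) := by
          have : ∀ u ∈ X, (∑ v ∈ X, if G.Adj u v then 1 else 0) =
              (∑ v ∈ X.erase l, if G.Adj u v then 1 else 0) := by
            intro u _
            refine (Finset.sum_subset (Finset.erase_subset _ _) ?_).symm
            intro v hv hv'
            have : v = l := by by_contra h; exact hv' (by simp [h, hv])
            simp [this, (hi u).2]
          rw [e2, Finset.sum_congr rfl this, e2]
          refine (Finset.sum_subset (Finset.erase_subset _ _) ?_).symm
          intro v hv hv'
          have : v = l := by by_contra h; exact hv' (by simp [h, hv])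
          simp [this, fun u => (hi u).1]
        have h3 := Finset.card_erase_add_one h.1
        omega
      · simpa using hG2 X
    · rw [e2_addE _ _ _ _ (hi w).1]
      simp only [Finset.mem_univ, and_self, if_true]
      omega
    · rw [valid_iff] at hG4 ⊢
      intro l' hl'
      rcases Finset.mem_insert.1 hl' with rfl | hl'
      · refine ⟨w, by simp [hwl, hwL], fun v => ?_⟩
        simp only [addE]
        constructor
        · rintro (h | h | h)
          · exact absurd h (hi v).1
          · exact h.2
          · exact absurd h.1 hlw
        · rintro rfl; simp
      · obtain ⟨w', hw', hw''⟩ := hG4 l' hl'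
        have hl'l : l' ≠ l := fun h => hlL (h ▸ hl')
        have hl'w : l' ≠ w := fun h => hwL (h ▸ hl')
        refine ⟨w', ?_, fun v => ?_⟩
        · have : w' ≠ l := by
            rintro rfl
            exact (hi l').2 ((hw'' _).2 rfl)
          simp [this, hw']
        · simp [addE, hl'l, hl'w, hw'']
  · rintro ⟨w, G⟩ ha ⟨w', G'⟩ ha' heq
    have hlw := hne _ ha
    have hlw' := hne _ ha'
    simp only [Finset.mem_product, Finset.mem_sdiff, Finset.mem_insert, Finset.mem_filter, PP,
      Finset.mem_univ, true_and, not_or] at ha ha' hlw hlw' heq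
    have hi := hiso G ha.2.1.1
    have hi' := hiso G' ha'.2.1.1
    have hadj : ∀ u v, (addE G l w hlw).Adj u v ↔ (addE G' l w' hlw').Adj u v := by
      intro u v; rw [heq]
    have hww : w = w' := by
      have := (hadj l w).1 (by simp [addE])
      simp only [addE] at this
      rcases this with h | h | h
      · exact absurd h (hi' w).1
      · exact h.2
      · exact absurd h.1 hlw'
    subst hww
    congr 1
    ext u v
    have h := hadj u v
    simp only [addE] at h
    by_cases hu : u = l
    · subst hu; simp [(hi v).1, (hi' v).1]
    by_cases hv : v = l
    · subst hv; simp [(hi u).2, (hi' u).2]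
    simpa [hu, hv] using h
  · intro G hG
    simp only [Finset.mem_filter, PP, Finset.mem_univ, true_and] at hG
    obtain ⟨⟨hG1, hG2, hG3⟩, hG4⟩ := hG
    rw [valid_iff] at hG4
    obtain ⟨w, hwL, hw⟩ := hG4 l (by simp)
    have hadd : l ≠ w := fun h => hwL (by simp [h])
    have hG : addE (remV G (fun v => v = l)) l w hadd = G := by
      ext u v
      simp only [addE, remV]
      by_cases hu : u = l
      · subst hu; simp [hw, hadd]
      by_cases hv : v = l
      · subst hv; rw [G.adj_comm]; simp [hw, hu]
      simp [hu, hv]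
    have hnadj : ¬ (remV G (fun v => v = l)).Adj l w := by simp [remV]
    refine ⟨(w, remV G (fun v => v = l)), ?_, hG⟩
    simp only [Finset.mem_product, Finset.mem_sdiff, Finset.mem_filter, PP,
      Finset.mem_univ, true_and]
    refine ⟨⟨hG1 w l ((hw w).2 rfl).symm, hwL⟩, ⟨?_, ?_, ?_⟩, ?_⟩
    · rintro u v ⟨h1, h2, h3⟩
      simp [h2, hG1 u v h1]
    · intro X
      have := hG2 X
      rw [← hG, e2_addE _ _ _ _ hnadj] at this
      omega
    · have := hG3
      rw [← hG, e2_addE _ _ _ _ hnadj] at this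
      simp only [Finset.mem_univ, and_self, if_true] at this
      omega
    · rw [valid_iff]
      intro l' hl'
      obtain ⟨w', h1, h2⟩ := hG4 l' (by simp [hl'])
      have hl'l : l' ≠ l := fun h => hlL (h ▸ hl')
      simp only [Finset.mem_insert, not_or] at h1
      refine ⟨w', h1.2, fun v => ?_⟩
      simp only [remV, h2, hl'l, not_false_eq_true, true_and]
      exact ⟨fun h => h.1, fun h => ⟨h, h ▸ h1.1⟩⟩

open scoped Classical in
lemma leaves_count {V : Type} [Fintype V] (r : ℕ) (L : Finset V) : ∀ (S : Finset V) (_ : L ⊆ S),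
    ((PP r S).filter fun G => Valid G L).card =
      (S \ L).card ^ L.card * (PP r (S \ L)).card := by
  induction L using Finset.induction_on with
  | empty => intro S _; simp [Valid]
  | insert l L hl ih =>
    intro S hS
    rw [leaf_count r S L l hl hS, ih (S.erase l), Finset.card_insert_of_notMem hl]
    · have : S.erase l \ L = S \ insert l L := by
        ext v; simp; tauto
      rw [this, pow_succ]; ring
    · intro v hv
      have : v ≠ l := fun h => hl (h ▸ hv)
      simp [this, hS (Finset.mem_insert_of_mem hv)]

/-- every leaf has a leaf as neighbour -/
def Good {V : Type} [Fintype V] (G : SimpleGraph V) : Prop :=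
  ∀ u w, G.Adj u w → dg G u = 1 → dg G w = 1

open scoped Classical in
/-- upper leaves -/
noncomputable def upL {V : Type} [Fintype V] [LinearOrder V] (G : SimpleGraph V) : Finset V :=
  Finset.univ.filter fun u => dg G u = 1 ∧ ∀ w, G.Adj u w → w < u

open scoped Classical in
/-- toggle set -/
noncomputable def togL {V : Type} [Fintype V] [LinearOrder V] (G : SimpleGraph V) (L : Finset V) :
    Finset V :=
  Finset.univ.filter fun u => dg G u = 1 ∧ ∀ w, G.Adj u w → w ∉ L ∧ (dg G w = 1 → u < w)

lemma dg_one_unique {V : Type} [Fintype V] {G : SimpleGraph V} {u v w : V} (h : dg G u = 1)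
    (hv : G.Adj u v) (hw : G.Adj u w) : v = w := by
  obtain ⟨x, _, hx⟩ := dg_eq_one.1 h
  rw [hx v hv, hx w hw]

lemma togL_symmDiff {V : Type} [Fintype V] [LinearOrder V] (G : SimpleGraph V) (L : Finset V) (u : V)
    (hu : u ∈ togL G L) : togL G (symmDiff L {u}) = togL G L := by
  simp only [togL, Finset.mem_filter, Finset.mem_univ, true_and] at hu
  ext x
  simp only [togL, Finset.mem_filter, Finset.mem_univ, true_and]
  refine and_congr_right fun hx => forall_congr' fun w => imp_congr_right fun hxw => ?_
  by_cases hwu : w = u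
  · subst hwu
    have h1 := hu.2 x hxw.symm
    have h2 := h1.2 hx
    constructor
    · intro h; exact absurd (h.2 hu.1) (not_lt.2 h2.le)
    · intro h; exact absurd (h.2 hu.1) (not_lt.2 h2.le)
  · simp [Finset.mem_symmDiff, hwu]

lemma valid_symmDiff {V : Type} [Fintype V] [LinearOrder V] (G : SimpleGraph V) (L : Finset V) (u : V)
    (hu : u ∈ togL G L) (hL : Valid G L) : Valid G (symmDiff L {u}) := by
  simp only [togL, Finset.mem_filter, Finset.mem_univ, true_and] at hu
  have key : ∀ l, l ∈ symmDiff L {u} → l ∈ L ∨ l = u := by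
    intro l hl
    rw [Finset.mem_symmDiff] at hl
    rcases hl with h | h
    · exact Or.inl h.1
    · right; simpa using h.1
  intro l hl
  refine ⟨?_, fun l' hl' hadj => ?_⟩
  · rcases key l hl with h | h
    · exact (hL l h).1
    · rw [h]; exact hu.1
  · rcases key l hl with h | h <;> rcases key l' hl' with h' | h'
    · exact (hL l h).2 l' h' hadj
    · subst h'; exact (hu.2 l hadj.symm).1 h
    · subst h; exact (hu.2 l' hadj).1 h'
    · subst h h'; exact G.loopless.irrefl _ hadj

open scoped Classical in
lemma sum_valid {V : Type} [Fintype V] [LinearOrder V] (G : SimpleGraph V) :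
    ∑ L ∈ (Finset.univ : Finset (Finset V)).filter (fun L => Valid G L), (-1 : ℝ) ^ L.card =
      if Good G then (-1) ^ (upL G).card else 0 := by
  rw [← Finset.sum_filter_add_sum_filter_not _ (fun L => (togL G L).Nonempty)]
  have h1 : ∑ L ∈ ((Finset.univ : Finset (Finset V)).filter (fun L => Valid G L)).filter
      (fun L => (togL G L).Nonempty), (-1 : ℝ) ^ L.card = 0 := by
    have hmem : ∀ L ∈ ((Finset.univ : Finset (Finset V)).filter (fun L => Valid G L)).filter
      (fun L => (togL G L).Nonempty), (togL G L).Nonempty ∧ Valid G L := by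
      intro L hL; simp only [Finset.mem_filter] at hL; exact ⟨hL.2, hL.1.2⟩
    refine Finset.sum_involution (fun L hL => symmDiff L {(togL G L).min' (hmem L hL).1}) ?_ ?_ ?_ ?_
    · intro L hL
      set u := (togL G L).min' (hmem L hL).1 with hu
      by_cases huL : u ∈ L
      · have : symmDiff L {u} = L.erase u := by
          ext x; simp [Finset.mem_symmDiff]
          by_cases hx : x = u <;> simp [hx, huL]
        rw [this, ← Finset.card_erase_add_one huL]
        ring
      · have : symmDiff L {u} = insert u L := by
          ext x; simp [Finset.mem_symmDiff]
          by_cases hx : x = u <;> simp [hx, huL]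
        rw [this, Finset.card_insert_of_notMem huL]
        ring
    · intro L hL _ h
      rw [symmDiff_eq_left] at h
      simp at h
    · intro L hL
      have hm := Finset.min'_mem _ (hmem L hL).1
      simp only [Finset.mem_filter, Finset.mem_univ, true_and]
      refine ⟨valid_symmDiff G L _ hm (hmem L hL).2, ?_⟩
      rw [togL_symmDiff G L _ hm]
      exact (hmem L hL).1
    · intro L hL
      have hm := Finset.min'_mem _ (hmem L hL).1
      simp only [togL_symmDiff G L _ hm]
      exact symmDiff_symmDiff_cancel_right _ _
  rw [h1, zero_add]
  split_ifs with hg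
  · have : ((Finset.univ : Finset (Finset V)).filter (fun L => Valid G L)).filter
      (fun L => ¬ (togL G L).Nonempty) = {upL G} := by
      ext L
      simp only [Finset.mem_filter, Finset.mem_univ, true_and, Finset.mem_singleton,
        Finset.not_nonempty_iff_eq_empty]
      constructor
      · rintro ⟨hL, hT⟩
        ext u
        constructor
        · intro hu
          have h1 := hL u hu
          simp only [upL, Finset.mem_filter, Finset.mem_univ, true_and]
          refine ⟨h1.1, fun w hw => ?_⟩
          by_contra hlt
          have hne : u ≠ w := G.ne_of_adj hw
          have hlt : u < w := lt_of_le_of_ne (not_lt.1 hlt) hne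
          have : u ∈ togL G L := by
            simp only [togL, Finset.mem_filter, Finset.mem_univ, true_and]
            refine ⟨h1.1, fun w' hw' => ?_⟩
            rw [dg_one_unique h1.1 hw' hw]
            exact ⟨fun h => h1.2 w h hw, fun _ => hlt⟩
          rw [hT] at this; simp at this
        · intro hu
          simp only [upL, Finset.mem_filter, Finset.mem_univ, true_and] at hu
          by_contra huL
          obtain ⟨w, hw, hw'⟩ := dg_eq_one.1 hu.1
          have : w ∈ togL G L := by
            simp only [togL, Finset.mem_filter, Finset.mem_univ, true_and]
            have hw1 := hg u w hw hu.1
            refine ⟨hw1, fun w' hww' => ?_⟩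
            rw [dg_one_unique hw1 hww' hw.symm]
            exact ⟨huL, fun _ => hu.2 w hw⟩
          rw [hT] at this; simp at this
      · rintro rfl
        constructor
        · intro l hl
          simp only [upL, Finset.mem_filter, Finset.mem_univ, true_and] at hl
          refine ⟨hl.1, fun l' hl' hadj => ?_⟩
          simp only [upL, Finset.mem_filter, Finset.mem_univ, true_and] at hl'
          exact lt_asymm (hl.2 l' hadj) (hl'.2 l hadj.symm)
        · rw [Finset.eq_empty_iff_forall_notMem]
          intro u hu
          simp only [togL, Finset.mem_filter, Finset.mem_univ, true_and] at hu
          obtain ⟨w, hw, hw'⟩ := dg_eq_one.1 hu.1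
          obtain ⟨h1, h2⟩ := hu.2 w hw
          have hw1 := hg u w hw hu.1
          apply h1
          simp only [upL, Finset.mem_filter, Finset.mem_univ, true_and]
          refine ⟨hw1, fun x hx => ?_⟩
          rw [dg_one_unique hw1 hx hw.symm]
          exact h2 hw1
    rw [this, Finset.sum_singleton]
  · apply Finset.sum_eq_zero
    intro L hL
    exfalso
    simp only [Finset.mem_filter, Finset.mem_univ, true_and] at hL
    apply hg
    intro u w huw hu
    by_contra hw
    apply hL.2
    refine ⟨u, ?_⟩
    simp only [togL, Finset.mem_filter, Finset.mem_univ, true_and]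
    refine ⟨hu, fun w' hw' => ?_⟩
    rw [dg_one_unique hu hw' huw]
    exact ⟨fun h => hw (hL.1 w h).1, fun h => absurd h hw⟩

/-- Main set-function identity. -/
lemma altSum_eq {V : Type} [Fintype V] [LinearOrder V] (r : ℕ) (R : Finset V) [DecidablePred (Good (V := V))] :
    ∑ L ∈ R.powerset, (-1 : ℝ) ^ L.card * (((R \ L).card : ℝ) ^ L.card * (PP r (R \ L)).card) =
      ∑ G ∈ (PP r R).filter Good, (-1 : ℝ) ^ (upL G).card := by
  classical
  have h1 : ∀ L ∈ R.powerset, (-1 : ℝ) ^ L.card * (((R \ L).card : ℝ) ^ L.card * (PP r (R \ L)).card)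
      = ∑ G ∈ PP r R, if Valid G L then (-1 : ℝ) ^ L.card else 0 := by
    intro L hL
    have h0 := leaves_count r L R (Finset.mem_powerset.1 hL)
    have : ((PP r R).filter fun G => Valid G L).card =
      (R \ L).card ^ L.card * (PP r (R \ L)).card := by convert h0
    rw [← Finset.sum_filter, Finset.sum_const, nsmul_eq_mul, this]
    push_cast; ring
  rw [Finset.sum_congr rfl h1, Finset.sum_comm, Finset.sum_filter]
  refine Finset.sum_congr rfl fun G hG => ?_
  have := sum_valid G
  rw [Finset.sum_filter] at this
  convert this using 1
  · apply Finset.sum_subset (Finset.subset_univ _)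
    intro L _ hL
    rw [if_neg]
    intro hv
    apply hL
    rw [Finset.mem_powerset]
    intro l hl
    obtain ⟨w, hw, _⟩ := dg_eq_one.1 (hv l hl).1
    simp only [PP, Finset.mem_filter] at hG
    exact hG.2.1 l w hw
  · split_ifs <;> rfl

open scoped Classical in
/-- graphs in which vertices of `Z` have degree `k` and all others are isolated -/
noncomputable def RG {V : Type} [Fintype V] (k : ℕ) (Z : Finset V) : Finset (SimpleGraph V) :=
  Finset.univ.filter fun G => ∀ v, dg G v = if v ∈ Z then k else 0

open scoped Classical in
/-- degree profile -/
def Prof {V : Type} [Fintype V] (Z J : Finset V) (G : SimpleGraph V) : Prop :=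
  Good G ∧ ∀ v, dg G v = if v ∈ Z then 2 else if v ∈ J then 1 else 0

lemma dg_pos {V : Type} [Fintype V] {G : SimpleGraph V} {u v : V} (h : G.Adj u v) : dg G u ≠ 0 := by
  intro h0; exact dg_eq_zero.1 h0 v h

lemma dg_le_two {V : Type} [Fintype V] {G : SimpleGraph V} (hG : Good G)
    (hs : ∀ X, e2 G X ≤ 2 * X.card) (v : V) : dg G v ≤ 2 := by
  classical
  set X : Finset V := Finset.univ.filter fun v => 2 ≤ dg G v with hX
  have hcl : ∀ u ∈ X, ∀ w, G.Adj u w → w ∈ X := by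
    intro u hu w huw
    simp only [hX, Finset.mem_filter, Finset.mem_univ, true_and] at hu ⊢
    have h0 := dg_pos huw.symm
    have h1 : dg G w ≠ 1 := fun h => by
      have := hG w u huw.symm h
      omega
    omega
  have he : e2 G X = ∑ u ∈ X, dg G u := by
    refine Finset.sum_congr rfl fun u hu => ?_
    refine Finset.sum_subset (Finset.subset_univ _) ?_
    intro w _ hw
    rw [if_neg]
    exact fun h => hw (hcl u hu w h)
  have h1 : ∑ u ∈ X, dg G u ≤ ∑ u ∈ X, 2 := by
    rw [← he, Finset.sum_const, smul_eq_mul, mul_comm]; exact hs X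
  by_contra hv
  have hvX : v ∈ X := by simp [hX]; omega
  have : ∑ u ∈ X, 2 < ∑ u ∈ X, dg G u := by
    refine Finset.sum_lt_sum (fun u hu => ?_) ⟨v, hvX, by omega⟩
    simpa [hX] using hu
  omega

lemma prof_sum {V : Type} [Fintype V] {Z J : Finset V} {G : SimpleGraph V} (hG : Prof Z J G)
    (hd : Disjoint Z J) : e2 G Finset.univ = 2 * Z.card + J.card := by
  classical
  rw [e2_univ]
  have : ∀ v, dg G v = (if v ∈ Z then 2 else 0) + (if v ∈ J then 1 else 0) := by
    intro v
    rw [hG.2 v]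
    by_cases h1 : v ∈ Z
    · have : v ∉ J := Finset.disjoint_left.1 hd h1
      simp [h1, this]
    · simp [h1]
  simp only [this, Finset.sum_add_distrib]
  simp [Finset.sum_ite_mem, mul_comm]

lemma prof_sparse {V : Type} [Fintype V] {Z J : Finset V} {G : SimpleGraph V} (hG : Prof Z J G)
    (X : Finset V) : e2 G X ≤ 2 * X.card := by
  refine (e2_le G X).trans ?_
  calc ∑ u ∈ X, dg G u ≤ ∑ u ∈ X, 2 := Finset.sum_le_sum fun u _ => by
        rw [hG.2 u]; split_ifs <;> omega
    _ = 2 * X.card := by rw [Finset.sum_const, smul_eq_mul, mul_comm]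

lemma prof_upL {V : Type} [Fintype V] [LinearOrder V] {Z J : Finset V} {G : SimpleGraph V}
    (hG : Prof Z J G) (hd : Disjoint Z J) : 2 * (upL G).card = J.card := by
  classical
  have hJ : ∀ v, v ∈ J ↔ dg G v = 1 := by
    intro v
    rw [hG.2 v]
    by_cases h1 : v ∈ Z
    · have : v ∉ J := Finset.disjoint_left.1 hd h1
      simp [h1, this]
    · simp [h1]
  let f : V → V → ℕ := fun u w => if G.Adj u w ∧ dg G u = 1 ∧ dg G w = 1 ∧ w < u then 1 else 0
  have hup : (upL G).card = ∑ u, ∑ w, f u w := by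
    rw [upL, Finset.card_filter]
    refine Finset.sum_congr rfl fun u _ => ?_
    by_cases hu : dg G u = 1
    · obtain ⟨w, hw, hw'⟩ := dg_eq_one.1 hu
      have hw1 := hG.1 u w hw hu
      rw [Finset.sum_eq_single w]
      · simp only [f, hu, hw, hw1, true_and]
        refine if_congr ⟨fun h => h w hw, fun h x hx => by rw [hw' x hx]; exact h⟩ rfl rfl
      · intro x _ hx
        simp only [f]; rw [if_neg]; exact fun h => hx (hw' x h.1)
      · simp
    · simp [f, hu]
  have hlo : (J \ upL G).card = ∑ u, ∑ w, f w u := by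
    have : J \ upL G = Finset.univ.filter (fun u => dg G u = 1 ∧ ¬ ∀ w, G.Adj u w → w < u) := by
      ext u; simp [upL, hJ]; tauto
    rw [this, Finset.card_filter]
    refine Finset.sum_congr rfl fun u _ => ?_
    by_cases hu : dg G u = 1
    · obtain ⟨w, hw, hw'⟩ := dg_eq_one.1 hu
      have hw1 := hG.1 u w hw hu
      rw [Finset.sum_eq_single w]
      · simp only [f, hu, hw.symm, hw1, true_and]
        refine if_congr ⟨fun h => ?_, fun h h' => ?_⟩ rfl rfl
        · by_contra hlt
          apply h
          intro x hx; rw [hw' x hx]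
          exact lt_of_le_of_ne (not_lt.1 hlt) (G.ne_of_adj hw).symm
        · exact lt_asymm h (h' w hw)
      · intro x _ hx
        simp only [f]; rw [if_neg]; exact fun h => hx (hw' x h.1.symm)
      · simp
    · simp [f, hu]
  have hsub : upL G ⊆ J := by
    intro u hu; simp only [upL, Finset.mem_filter] at hu; exact (hJ u).2 hu.2.1
  have h3 := Finset.card_sdiff_add_card_eq_card hsub
  rw [hlo, Finset.sum_comm, ← hup] at h3
  omega

open scoped Classical in
lemma prof_card {V : Type} [Fintype V] {Z J : Finset V} (hd : Disjoint Z J) :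
    (Finset.univ.filter (Prof Z J)).card = (RG 2 Z).card * (RG 1 J).card := by
  rw [← Finset.card_product]
  symm
  have hsup : ∀ H M : SimpleGraph V, H ∈ RG 2 Z → M ∈ RG 1 J →
      (∀ u v, H.Adj u v → u ∈ Z) ∧ (∀ u v, M.Adj u v → u ∈ J) := by
    intro H M hH hM
    simp only [RG, Finset.mem_filter, Finset.mem_univ, true_and] at hH hM
    constructor
    · intro u v h
      by_contra hu
      have := hH u
      rw [if_neg hu] at this
      exact dg_pos h this
    · intro u v h
      by_contra hu
      have := hM u
      rw [if_neg hu] at this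
      exact dg_pos h this
  have hdis := Finset.disjoint_left.1 hd
  refine Finset.card_bij (fun a _ => a.1 ⊔ a.2) ?_ ?_ ?_
  · rintro ⟨H, M⟩ ha
    simp only [Finset.mem_product] at ha
    obtain ⟨h1, h2⟩ := hsup H M ha.1 ha.2
    simp only [RG, Finset.mem_filter, Finset.mem_univ, true_and] at ha ⊢
    have hdeg : ∀ v, dg (H ⊔ M) v = if v ∈ Z then 2 else if v ∈ J then 1 else 0 := by
      intro v
      have : dg (H ⊔ M) v = dg H v + dg M v := by
        simp only [dg, ← Finset.sum_add_distrib]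
        refine Finset.sum_congr rfl fun w _ => ?_
        by_cases hH : H.Adj v w
        · have : ¬ M.Adj v w := fun h => hdis (h1 v w hH) (h2 v w h)
          simp [hH, this]
        · simp [hH]
      rw [this, ha.1, ha.2]
      by_cases h1 : v ∈ Z
      · simp [h1, hdis h1]
      · simp [h1]
    refine ⟨?_, hdeg⟩
    intro u w huw hu
    rw [hdeg] at hu ⊢
    have huZ : u ∉ Z := by intro h; simp [h] at hu
    rcases huw with h | h
    · exact absurd (h1 u w h) huZ
    · have hw := h2 w u h.symm
      rw [if_neg (fun h => hdis h hw), if_pos hw]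
  · rintro ⟨H, M⟩ ha ⟨H', M'⟩ ha' heq
    simp only [Finset.mem_product] at ha ha'
    obtain ⟨h1, h2⟩ := hsup H M ha.1 ha.2
    obtain ⟨h1', h2'⟩ := hsup H' M' ha'.1 ha'.2
    simp only at heq
    have hadj : ∀ u v, (H.Adj u v ∨ M.Adj u v) ↔ (H'.Adj u v ∨ M'.Adj u v) := by
      intro u v
      have : (H ⊔ M).Adj u v ↔ (H' ⊔ M').Adj u v := by rw [heq]
      simpa using this
    rw [Prod.mk.injEq]
    constructor <;> ext u v
    · constructor
      · intro h
        exact ((hadj u v).1 (Or.inl h)).resolve_right fun h' => hdis (h1 u v h) (h2' u v h')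
      · intro h
        exact ((hadj u v).2 (Or.inl h)).resolve_right fun h' => hdis (h1' u v h) (h2 u v h')
    · constructor
      · intro h
        exact ((hadj u v).1 (Or.inr h)).resolve_left fun h' => hdis (h1' u v h') (h2 u v h)
      · intro h
        exact ((hadj u v).2 (Or.inr h)).resolve_left fun h' => hdis (h1 u v h') (h2' u v h)
  · intro G hG
    simp only [Finset.mem_filter, Finset.mem_univ, true_and] at hG
    obtain ⟨hgood, hdeg⟩ := hG
    have hZ : ∀ u w, G.Adj u w → (u ∈ Z → w ∈ Z) := by
      intro u w huw hu
      by_contra hw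
      have h0 := dg_pos huw.symm
      have hwd := hdeg w
      rw [if_neg hw] at hwd
      have hw1 : dg G w = 1 := by
        split_ifs at hwd <;> omega
      have := hgood w u huw.symm hw1
      rw [hdeg u, if_pos hu] at this
      omega
    have hJ : ∀ u w, G.Adj u w → (u ∉ Z → u ∈ J) := by
      intro u w huw hu
      by_contra hw
      have := hdeg u
      rw [if_neg hu, if_neg hw] at this
      exact dg_pos huw this
    refine ⟨(remV G (fun v => v ∉ Z), remV G (fun v => v ∈ Z)), ?_, ?_⟩
    · simp only [Finset.mem_product, RG, Finset.mem_filter, Finset.mem_univ, true_and]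
      constructor
      · intro v
        by_cases hv : v ∈ Z
        · have : dg (remV G (fun v => v ∉ Z)) v = dg G v := by
            refine Finset.sum_congr rfl fun w _ => if_congr ?_ rfl rfl
            simp only [remV, not_not]
            exact ⟨fun h => h.1, fun h => ⟨h, hv, hZ v w h hv⟩⟩
          rw [this, hdeg v, if_pos hv, if_pos hv]
        · rw [if_neg hv, dg_eq_zero]
          intro w h
          exact h.2.1 hv
      · intro v
        by_cases hv : v ∈ Z
        · rw [if_neg (hdis hv), dg_eq_zero]
          intro w h
          exact h.2.1 hv
        · have : dg (remV G (fun v => v ∈ Z)) v = dg G v := by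
            refine Finset.sum_congr rfl fun w _ => if_congr ?_ rfl rfl
            simp only [remV]
            exact ⟨fun h => h.1, fun h => ⟨h, hv, fun h' => hv (hZ w v h.symm h')⟩⟩
          rw [this, hdeg v, if_neg hv]
    · ext u v
      simp only [SimpleGraph.sup_adj, remV, not_not]
      constructor
      · rintro (h | h) <;> exact h.1
      · intro h
        by_cases hu : u ∈ Z
        · exact Or.inl ⟨h, hu, hZ u v h hu⟩
        · exact Or.inr ⟨h, hu, fun h' => hu (hZ v u h.symm h')⟩

lemma good_sum {V : Type} [Fintype V] [LinearOrder V] (r : ℕ) (R : Finset V)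
    [DecidablePred (Good (V := V))] :
    ∑ G ∈ (PP r R).filter Good, (-1 : ℝ) ^ (upL G).card =
      ∑ Z ∈ R.powerset, ((RG 2 Z).card : ℝ) * ∑ J ∈ (R \ Z).powerset,
        if J.card + 2 * r = 2 * (R \ Z).card then (-1 : ℝ) ^ (J.card / 2) * (RG 1 J).card else 0 := by
  classical
  let zf : SimpleGraph V → Finset V := fun G => Finset.univ.filter fun v => dg G v = 2
  let jf : SimpleGraph V → Finset V := fun G => Finset.univ.filter fun v => dg G v = 1
  have hnz : ∀ G ∈ (PP r R).filter Good, ∀ v, dg G v ≠ 0 → v ∈ R := by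
    intro G hG v hv
    simp only [PP, Finset.mem_filter] at hG
    by_contra hvR
    apply hv
    rw [dg_eq_zero]
    intro w hw
    exact hvR (hG.1.2.1 v w hw)
  have hz : ∀ G ∈ (PP r R).filter Good, zf G ∈ R.powerset := by
    intro G hG
    rw [Finset.mem_powerset]
    intro v hv
    simp only [zf, Finset.mem_filter] at hv
    exact hnz G hG v (by omega)
  rw [← Finset.sum_fiberwise_of_maps_to hz]
  refine Finset.sum_congr rfl fun Z hZ => ?_
  have hj : ∀ G ∈ ((PP r R).filter Good).filter (fun G => zf G = Z), jf G ∈ (R \ Z).powerset := by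
    intro G hG
    rw [Finset.mem_filter] at hG
    rw [Finset.mem_powerset]
    intro v hv
    simp only [jf, Finset.mem_filter] at hv
    rw [Finset.mem_sdiff]
    refine ⟨hnz G hG.1 v (by omega), ?_⟩
    rw [← hG.2]
    simp only [zf, Finset.mem_filter]
    omega
  rw [← Finset.sum_fiberwise_of_maps_to hj, Finset.mul_sum]
  refine Finset.sum_congr rfl fun J hJ => ?_
  rw [Finset.mem_powerset] at hZ hJ
  have hd : Disjoint Z J := by
    rw [Finset.disjoint_left]
    intro v hv hv'
    exact (Finset.mem_sdiff.1 (hJ hv')).2 hv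
  have hRZ : (R \ Z).card + Z.card = R.card := Finset.card_sdiff_add_card_eq_card hZ
  have hprof : ∀ G ∈ (((PP r R).filter Good).filter (fun G => zf G = Z)).filter (fun G => jf G = J),
      Prof Z J G := by
    intro G hG
    simp only [Finset.mem_filter] at hG
    obtain ⟨⟨⟨hP, hg⟩, h1⟩, h2⟩ := hG
    refine ⟨hg, fun v => ?_⟩
    simp only [PP, Finset.mem_filter] at hP
    have h3 := dg_le_two hg hP.2.2.1 v
    rw [← h1, ← h2]
    simp only [zf, jf, Finset.mem_filter, Finset.mem_univ, true_and]
    split_ifs <;> omega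
  split_ifs with hc
  · have hset : (((PP r R).filter Good).filter (fun G => zf G = Z)).filter (fun G => jf G = J)
        = Finset.univ.filter (Prof Z J) := by
      ext G
      refine ⟨fun h => by simpa using hprof G h, fun h => ?_⟩
      have h : Prof Z J G := by simpa using h
      simp only [Finset.mem_filter, PP, Finset.mem_univ, true_and]
      refine ⟨⟨⟨⟨?_, prof_sparse h, ?_⟩, h.1⟩, ?_⟩, ?_⟩
      · intro u v huv
        by_contra hu
        have h1 : u ∉ Z := fun h => hu (hZ h)
        have h2 : u ∉ J := fun h => hu (Finset.mem_sdiff.1 (hJ h)).1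
        have := h.2 u
        rw [if_neg h1, if_neg h2] at this
        exact dg_pos huv this
      · rw [prof_sum h hd]; omega
      · ext v
        simp only [zf, Finset.mem_filter, Finset.mem_univ, true_and, h.2 v]
        by_cases h1 : v ∈ Z <;> by_cases h2 : v ∈ J <;> simp [h1, h2]
      · ext v
        simp only [jf, Finset.mem_filter, Finset.mem_univ, true_and, h.2 v]
        have : v ∈ Z → v ∉ J := fun h => Finset.disjoint_left.1 hd h
        by_cases h1 : v ∈ Z <;> by_cases h2 : v ∈ J <;> simp_all
    rw [hset]
    have : ∀ G ∈ Finset.univ.filter (Prof Z J), (-1 : ℝ) ^ (upL G).card = (-1) ^ (J.card / 2) := by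
      intro G hG
      have h : Prof Z J G := by simpa using hG
      rw [← prof_upL h hd]
      simp
    have hpc : (Finset.univ.filter (Prof Z J)).card = (RG 2 Z).card * (RG 1 J).card := by
      convert prof_card hd
    rw [Finset.sum_congr rfl this, Finset.sum_const, nsmul_eq_mul, hpc]
    push_cast; ring
  · rw [mul_zero]
    apply Finset.sum_eq_zero
    intro G hG
    exfalso
    apply hc
    have h1 := prof_sum (hprof G hG) hd
    simp only [Finset.mem_filter, PP] at hG
    have h2 := hG.1.1.1.2.2.2
    omega

lemma dg_addE {V : Type} [Fintype V] [DecidableEq V] (G : SimpleGraph V) (l w : V) (h : l ≠ w)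
    (hl : ¬ G.Adj l w) (u : V) :
    dg (addE G l w h) u = dg G u + if u = l ∨ u = w then 1 else 0 := by
  classical
  have key : ∀ v, (if (addE G l w h).Adj u v then 1 else 0) =
      (if G.Adj u v then 1 else 0) + ((if v = w then (if u = l then 1 else 0) else 0)
        + (if v = l then (if u = w then 1 else 0) else 0)) := by
    intro v
    have hl' : ¬ G.Adj w l := fun h => hl h.symm
    have h' : w ≠ l := h.symm
    by_cases h1 : u = l <;> by_cases h2 : v = w <;> by_cases h3 : u = w <;> by_cases h4 : v = l <;>
      simp_all [addE]
  simp only [dg, key, Finset.sum_add_distrib]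
  congr 1
  simp only [Finset.sum_ite_eq', Finset.mem_univ, if_true]
  by_cases h1 : u = l
  · subst h1; simp [h]
  · simp [h1]

open scoped Classical in
lemma RG1_rec {V : Type} [Fintype V] (J : Finset V) (x : V) (hx : x ∈ J) :
    (RG 1 J).card = ∑ y ∈ J.erase x, (RG 1 ((J.erase x).erase y)).card := by
  rw [← Finset.card_sigma]
  symm
  have hne : ∀ a ∈ (J.erase x).sigma (fun y => RG 1 ((J.erase x).erase y)), x ≠ a.1 := by
    rintro ⟨y, M⟩ ha
    simp only [Finset.mem_sigma, Finset.mem_erase] at ha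
    exact fun h => ha.1.1 h.symm
  have hiso : ∀ (K : Finset V) (M : SimpleGraph V), M ∈ RG 1 K → ∀ u, u ∉ K → ∀ v, ¬ M.Adj u v := by
    intro K M hM u hu
    simp only [RG, Finset.mem_filter, Finset.mem_univ, true_and] at hM
    have := hM u
    rw [if_neg hu] at this
    exact dg_eq_zero.1 this
  refine Finset.card_bij (fun a ha => addE a.2 x a.1 (hne a ha)) ?_ ?_ ?_
  · rintro ⟨y, M⟩ ha
    have hxy := hne _ ha
    simp only [Finset.mem_sigma] at ha
    have hi := hiso _ M ha.2
    simp only [RG, Finset.mem_filter, Finset.mem_univ, true_and, Finset.mem_erase] at ha ⊢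
    intro v
    rw [dg_addE _ _ _ _ (hi x (by simp) y), ha.2 v]
    by_cases h1 : v = x
    · simp [h1, hx]
    · by_cases h2 : v = y
      · simp [h2, ha.1.2]
      · simp [h1, h2]
  · rintro ⟨y, M⟩ ha ⟨y', M'⟩ ha' heq
    have hxy := hne _ ha
    have hxy' := hne _ ha'
    simp only [Finset.mem_sigma] at ha ha' hxy hxy' heq
    have hi := hiso _ M ha.2
    have hi' := hiso _ M' ha'.2
    have hadj : ∀ u v, (addE M x y hxy).Adj u v ↔ (addE M' x y' hxy').Adj u v := by
      intro u v; rw [heq]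
    have hyy : y = y' := by
      have := (hadj x y).1 (by simp [addE])
      simp only [addE] at this
      rcases this with h | h | h
      · exact absurd h (hi' x (by simp) y)
      · exact h.2
      · exact absurd h.1 hxy'
    subst hyy
    congr 1
    ext u v
    have h := hadj u v
    simp only [addE] at h
    by_cases hu : u = x
    · subst hu; simp [hi u (by simp) v, hi' u (by simp) v]
    by_cases hv : v = x
    · subst hv; rw [M.adj_comm, M'.adj_comm]; simp [hi v (by simp) u, hi' v (by simp) u]
    simpa [hu, hv] using h
  · intro G hG
    simp only [Finset.mem_filter, RG, Finset.mem_univ, true_and] at hG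
    have hx1 := hG x
    rw [if_pos hx] at hx1
    obtain ⟨y, hy, hy'⟩ := dg_eq_one.1 hx1
    have hyJ : y ∈ J := by
      by_contra h
      have := hG y
      rw [if_neg h] at this
      exact dg_pos hy.symm this
    have hy1 := hG y
    rw [if_pos hyJ] at hy1
    have hxy : x ≠ y := G.ne_of_adj hy
    have hGe : addE (remV G (fun v => v = x ∨ v = y)) x y hxy = G := by
      ext u v
      simp only [addE, remV]
      by_cases hu : u = x
      · subst hu
        simp only [true_or, not_true, false_and, and_false, false_or, true_and]
        constructor
        · rintro (h | h)
          · rw [h]; exact hy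
          · exact absurd h.1 hxy
        · intro h; exact Or.inl (hy' v h)
      by_cases hv : v = x
      · subst hv
        simp only [hu, true_or, not_true, false_and, and_false, false_or, and_true]
        constructor
        · intro h; rw [h]; exact hy.symm
        · intro h; exact hy' u h.symm
      by_cases hu' : u = y
      · subst hu'
        simp only [hu, hv, or_true, not_true, false_and, and_false, false_or, false_iff]
        intro h
        exact hv (dg_one_unique hy1 h hy.symm)
      by_cases hv' : v = y
      · subst hv'
        simp only [hu, hv, or_true, not_true, false_and, and_false, false_or, false_iff]
        intro h
        exact hu (dg_one_unique hy1 h.symm hy.symm)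
      simp [hu, hv, hu', hv']
    have hnadj : ¬ (remV G (fun v => v = x ∨ v = y)).Adj x y := by simp [remV]
    refine ⟨⟨y, remV G (fun v => v = x ∨ v = y)⟩, ?_, hGe⟩
    simp only [Finset.mem_sigma, RG, Finset.mem_filter, Finset.mem_univ, true_and, Finset.mem_erase]
    refine ⟨⟨hxy.symm, hyJ⟩, fun v => ?_⟩
    have h1 := hG v
    rw [← hGe, dg_addE _ _ _ _ hnadj] at h1
    by_cases h2 : v = x
    · simp [h2, hx] at h1 ⊢; exact h1
    by_cases h3 : v = y
    · simp [h3, hyJ] at h1 ⊢; exact h1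
    simpa [h2, h3] using h1

lemma RG1_card {V : Type} [Fintype V] (j : ℕ) : ∀ J : Finset V, J.card = 2 * j →
    (RG 1 J).card * (2 ^ j * j.factorial) = (2 * j).factorial := by
  classical
  induction j with
  | zero =>
    intro J hJ
    have hJ : J = ∅ := by simpa using hJ
    subst hJ
    have : (RG 1 (∅ : Finset V)) = {⊥} := by
      ext G
      simp only [RG, Finset.mem_filter, Finset.mem_univ, true_and, Finset.notMem_empty, if_false,
        Finset.mem_singleton, dg_eq_zero]
      constructor
      · intro h; ext u v; simp [h u v]
      · rintro rfl; simp
    simp [this]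
  | succ j ih =>
    intro J hJ
    have : J.Nonempty := by rw [← Finset.card_pos]; omega
    obtain ⟨x, hx⟩ := this
    have hc := Finset.card_erase_add_one hx
    have hrec : (RG 1 J).card = ∑ y ∈ J.erase x, (RG 1 ((J.erase x).erase y)).card := by
      convert RG1_rec J x hx
    rw [hrec, Finset.sum_mul]
    have : ∀ y ∈ J.erase x, (RG 1 ((J.erase x).erase y)).card * (2 ^ (j + 1) * (j + 1).factorial)
        = 2 * (j + 1) * (2 * j).factorial := by
      intro y hy
      have hc' := Finset.card_erase_add_one hy
      rw [← ih ((J.erase x).erase y) (by omega), Nat.factorial_succ, pow_succ]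
      ring
    rw [Finset.sum_congr rfl this, Finset.sum_const, smul_eq_mul]
    have h3 : (J.erase x).card = 2 * j + 1 := by omega
    rw [h3, show 2 * (j + 1) = (2 * j + 1) + 1 by ring, Nat.factorial_succ (2 * j + 1),
      Nat.factorial_succ (2 * j)]
    ring

lemma dg_eq_two {V : Type} [Fintype V] [LinearOrder V] {G : SimpleGraph V} {u : V}
    (h : dg G u = 2) : ∃ a b, a < b ∧ ∀ v, G.Adj u v ↔ v = a ∨ v = b := by
  classical
  rw [dg, ← Finset.card_filter, Finset.card_eq_two] at h
  obtain ⟨a, b, hab, h⟩ := h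
  have key : ∀ v, G.Adj u v ↔ v = a ∨ v = b := by
    intro v
    have : v ∈ Finset.filter (fun v => G.Adj u v) Finset.univ ↔ v ∈ ({a, b} : Finset V) := by rw [h]
    simpa using this
  rcases lt_or_gt_of_ne hab with h1 | h1
  · exact ⟨a, b, h1, key⟩
  · exact ⟨b, a, h1, fun v => by rw [key, or_comm]⟩

open scoped Classical in
/-- labels of half edges -/
noncomputable def labl {V : Type} [LinearOrder V] (G : SimpleGraph V) (c : Finset V) (u v : V) : Bool :=
  xor (decide (∃ v', G.Adj u v' ∧ v' < v)) (decide (u ∈ c))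

/-- configuration -/
def confG {V : Type} [LinearOrder V] (G : SimpleGraph V) (c : Finset V) : SimpleGraph (V × Bool) where
  Adj x y := G.Adj x.1 y.1 ∧ labl G c x.1 y.1 = x.2 ∧ labl G c y.1 x.1 = y.2
  symm := ⟨fun _ _ h => ⟨h.1.symm, h.2.2, h.2.1⟩⟩
  loopless := ⟨fun _ h => G.loopless.irrefl _ h.1⟩

lemma labl_unique {V : Type} [Fintype V] [LinearOrder V] {G : SimpleGraph V} {u : V} (c : Finset V)
    (h : dg G u = 2) (a : Bool) : ∃ v, G.Adj u v ∧ labl G c u v = a ∧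
      ∀ w, G.Adj u w → labl G c u w = a → w = v := by
  classical
  obtain ⟨x, y, hxy, hadj⟩ := dg_eq_two h
  have hx : ¬ (∃ v', G.Adj u v' ∧ v' < x) := by
    simp only [not_exists, not_and, not_lt, hadj]
    rintro v' (h | h) <;> rw [h]
    exact hxy.le
  have hy : (∃ v', G.Adj u v' ∧ v' < y) := by
    exact ⟨x, (hadj x).2 (Or.inl rfl), hxy⟩
  have hlx : labl G c u x = decide (u ∈ c) := by
    simp only [labl, hx, decide_false, Bool.false_xor]
  have hly : labl G c u y = !decide (u ∈ c) := by
    simp only [labl, hy, decide_true, Bool.true_xor]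
  by_cases ha : a = decide (u ∈ c)
  · refine ⟨x, (hadj x).2 (Or.inl rfl), by rw [hlx, ha], fun w hw hw' => ?_⟩
    rcases (hadj w).1 hw with h | h
    · exact h
    · rw [h, hly, ha] at hw'
      simp at hw'
  · have ha' : a = !decide (u ∈ c) := by
      cases a <;> cases h : decide (u ∈ c) <;> simp_all
    refine ⟨y, (hadj y).2 (Or.inr rfl), by rw [hly, ha'], fun w hw hw' => ?_⟩
    rcases (hadj w).1 hw with h | h
    · rw [h, hlx] at hw'
      exact absurd hw'.symm ha
    · exact h

lemma RG2_le {V : Type} [Fintype V] [LinearOrder V] (Z : Finset V) :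
    (RG 2 Z).card * 2 ^ Z.card ≤ (RG 1 (Z ×ˢ (Finset.univ : Finset Bool))).card := by
  classical
  rw [← Finset.card_powerset, ← Finset.card_product]
  have hdZ : ∀ G : SimpleGraph V, G ∈ RG 2 Z → ∀ u, u ∈ Z → dg G u = 2 := by
    intro G hG u hu
    simp only [RG, Finset.mem_filter, Finset.mem_univ, true_and] at hG
    rw [hG u, if_pos hu]
  have hadjZ : ∀ G : SimpleGraph V, G ∈ RG 2 Z → ∀ u v, G.Adj u v → u ∈ Z := by
    intro G hG u v huv
    by_contra hu
    simp only [RG, Finset.mem_filter, Finset.mem_univ, true_and] at hG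
    have := hG u
    rw [if_neg hu] at this
    exact dg_pos huv this
  refine Finset.card_le_card_of_injOn (fun a => confG a.1 a.2) ?_ ?_
  · rintro ⟨G, c⟩ ha
    simp only [Finset.coe_product, Set.mem_prod, Finset.mem_coe] at ha
    obtain ⟨hG, hc⟩ := ha
    simp only [RG, Finset.mem_filter, Finset.mem_univ, true_and, Finset.mem_product, and_true,
      Finset.mem_coe]
    rintro ⟨u, a⟩
    by_cases hu : u ∈ Z
    · simp only [hu, if_true]
      rw [dg_eq_one]
      obtain ⟨v, hv, hv', hv''⟩ := labl_unique c (hdZ G hG u hu) a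
      refine ⟨(v, labl G c v u), ⟨hv, hv', rfl⟩, ?_⟩
      rintro ⟨w, b⟩ ⟨h1, h2, h3⟩
      simp only at h1 h2 h3
      have := hv'' w h1 h2
      subst this
      rw [h3]
    · simp only [hu, if_false]
      rw [dg_eq_zero]
      rintro ⟨w, b⟩ ⟨h1, h2, h3⟩
      exact hu (hadjZ G hG u w h1)
  · rintro ⟨G, c⟩ ha ⟨G', c'⟩ ha' heq
    simp only [Finset.coe_product, Set.mem_prod, Finset.mem_coe, Finset.mem_powerset] at ha ha' heq
    have hadj : ∀ x y, (confG G c).Adj x y ↔ (confG G' c').Adj x y := by intro x y; rw [heq]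
    have hGG : G = G' := by
      ext u v
      constructor
      · intro h
        have : (confG G c).Adj (u, labl G c u v) (v, labl G c v u) := ⟨h, rfl, rfl⟩
        exact ((hadj _ _).1 this).1
      · intro h
        have : (confG G' c').Adj (u, labl G' c' u v) (v, labl G' c' v u) := ⟨h, rfl, rfl⟩
        exact ((hadj _ _).2 this).1
    subst hGG
    congr 1
    have key : ∀ u ∈ Z, (u ∈ c ↔ u ∈ c') := by
      intro u hu
      obtain ⟨v, hv, _⟩ := labl_unique c (hdZ G ha.1 u hu) true
      have : (confG G c).Adj (u, labl G c u v) (v, labl G c v u) := ⟨hv, rfl, rfl⟩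
      have h2 := ((hadj _ _).1 this).2.1
      simp only [labl] at h2
      have h3 : decide (u ∈ c') = decide (u ∈ c) := by
        exact Bool.xor_right_inj.1 h2.symm |>.symm
      simpa using h3.symm
    ext u
    constructor
    · intro h; exact (key u (ha.2 h)).1 h
    · intro h; exact (key u (ha'.2 h)).2 h

lemma RG2_bound {V : Type} [Fintype V] [LinearOrder V] (Z : Finset V) :
    (RG 2 Z).card * (4 ^ Z.card * Z.card.factorial) ≤ (2 * Z.card).factorial := by
  have h1 := RG2_le Z
  have h2 := RG1_card Z.card (Z ×ˢ (Finset.univ : Finset Bool)) (by simp [mul_comm])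
  rw [← h2]
  calc (RG 2 Z).card * (4 ^ Z.card * Z.card.factorial)
      = ((RG 2 Z).card * 2 ^ Z.card) * (2 ^ Z.card * Z.card.factorial) := by
        rw [show (4 : ℕ) = 2 * 2 by norm_num, mul_pow]; ring
    _ ≤ _ := Nat.mul_le_mul_right _ h1

lemma sum_split {V : Type} [DecidableEq V] (S : Finset V) (F : Finset V → Finset V → ℝ) :
    ∑ R ∈ S.powerset, ∑ Z ∈ R.powerset, F Z (R \ Z) =
      ∑ Z ∈ S.powerset, ∑ Y ∈ (S \ Z).powerset, F Z Y := by
  rw [Finset.sum_sigma', Finset.sum_sigma']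
  refine Finset.sum_bij' (fun a _ => ⟨a.2, a.1 \ a.2⟩) (fun a _ => ⟨a.1 ∪ a.2, a.1⟩) ?_ ?_ ?_ ?_ ?_
  · rintro ⟨R, Z⟩ h
    simp only [Finset.mem_sigma, Finset.mem_powerset] at h ⊢
    exact ⟨h.2.trans h.1, Finset.sdiff_subset_sdiff h.1 le_rfl⟩
  · rintro ⟨Z, Y⟩ h
    simp only [Finset.mem_sigma, Finset.mem_powerset] at h ⊢
    exact ⟨Finset.union_subset h.1 (h.2.trans Finset.sdiff_subset), Finset.subset_union_left⟩
  · rintro ⟨R, Z⟩ h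
    simp only [Finset.mem_sigma, Finset.mem_powerset] at h ⊢
    rw [Finset.union_sdiff_of_subset h.2]
  · rintro ⟨Z, Y⟩ h
    simp only [Finset.mem_sigma, Finset.mem_powerset] at h ⊢
    have : (Z ∪ Y) \ Z = Y := by
      ext v
      have : v ∈ Y → v ∉ Z := fun hv => (Finset.mem_sdiff.1 (h.2 hv)).2
      simp only [Finset.mem_sdiff, Finset.mem_union]; tauto
    rw [this]
  · rintro ⟨R, Z⟩ h; rfl

lemma sum_compl {V : Type} [DecidableEq V] (R : Finset V) (F : Finset V → Finset V → ℝ) :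
    ∑ L ∈ R.powerset, F (R \ L) L = ∑ L ∈ R.powerset, F L (R \ L) := by
  refine Finset.sum_bij' (fun a _ => R \ a) (fun a _ => R \ a) ?_ ?_ ?_ ?_ ?_
  · intro a _; simp
  · intro a _; simp
  · intro a h; simp only [Finset.mem_powerset] at h; simp [h]
  · intro a h; simp only [Finset.mem_powerset] at h; simp [h]
  · intro a h; simp only [Finset.mem_powerset] at h; simp [h]

lemma sum_id_choose (M : ℕ) (x y : ℝ) :
    ∑ l ∈ Finset.range (M + 1), (M.choose l : ℝ) * (x ^ l * (l : ℝ) * y ^ (M - l)) =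
      M * x * (x + y) ^ (M - 1) := by
  cases M with
  | zero => simp
  | succ M =>
    rw [Finset.sum_range_succ']
    simp only [Nat.add_sub_cancel, add_pow, Finset.mul_sum]
    simp only [Nat.cast_zero, mul_zero, zero_mul, add_zero]
    refine Finset.sum_congr rfl fun l hl => ?_
    have h := Nat.add_one_mul_choose_eq M l
    have h' : ((M : ℝ) + 1) * (M.choose l) = ((M + 1).choose (l + 1)) * (l + 1) := by exact_mod_cast h
    rw [Nat.add_sub_add_right, pow_succ]
    push_cast
    linear_combination (-(x ^ l * x * y ^ (M - l))) * h'

lemma sum_bin2 (M : ℕ) (q x y : ℝ) :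
    ∑ l ∈ Finset.range (M + 1), (M.choose l : ℝ) * (x ^ l * (q + (l : ℝ)) * y ^ (M - l)) =
      q * (x + y) ^ M + M * x * (x + y) ^ (M - 1) := by
  rw [← sum_id_choose, add_pow, Finset.mul_sum, ← Finset.sum_add_distrib]
  refine Finset.sum_congr rfl fun l hl => ?_
  ring

lemma inversion {V : Type} [DecidableEq V] (S : Finset V) (hS : 0 < S.card) (f : Finset V → ℝ) :
    f S = ∑ R ∈ S.powerset, ((R.card : ℝ) * (S.card : ℝ) ^ (S.card - R.card) / S.card) *
      ∑ L ∈ R.powerset, (-1 : ℝ) ^ L.card * (((R \ L).card : ℝ) ^ L.card * f (R \ L)) := by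
  have hN : (S.card : ℝ) ≠ 0 := by positivity
  let F : Finset V → Finset V → ℝ := fun Q L =>
    (((Q.card : ℝ) + L.card) * (S.card : ℝ) ^ (S.card - (Q.card + L.card)) / S.card) *
      ((-1 : ℝ) ^ L.card * ((Q.card : ℝ) ^ L.card * f Q))
  have h1 : ∀ R ∈ S.powerset, ((R.card : ℝ) * (S.card : ℝ) ^ (S.card - R.card) / S.card) *
      ∑ L ∈ R.powerset, (-1 : ℝ) ^ L.card * (((R \ L).card : ℝ) ^ L.card * f (R \ L)) =
      ∑ L ∈ R.powerset, F L (R \ L) := by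
    intro R _
    rw [← sum_compl, Finset.mul_sum]
    refine Finset.sum_congr rfl fun L hL => ?_
    have : (R \ L).card + L.card = R.card :=
      Finset.card_sdiff_add_card_eq_card (Finset.mem_powerset.1 hL)
    have h' : ((R \ L).card : ℝ) + L.card = R.card := by exact_mod_cast this
    simp only [F]
    rw [h', this]
  rw [Finset.sum_congr rfl h1, sum_split S F]
  rw [Finset.sum_eq_single S]
  · simp only [sdiff_self, Finset.bot_eq_empty, Finset.powerset_empty, Finset.sum_singleton, F]
    simp
    field_simp
  · intro Q hQ hne
    rw [Finset.mem_powerset] at hQ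
    have hc : (S \ Q).card + Q.card = S.card := Finset.card_sdiff_add_card_eq_card hQ
    have hpos : 0 < (S \ Q).card := by
      rw [Finset.card_pos, Finset.sdiff_nonempty]
      exact fun h => hne (Finset.Subset.antisymm hQ h)
    have h2 := Finset.sum_powerset_apply_card (fun l =>
      (((Q.card : ℝ) + l) * (S.card : ℝ) ^ (S.card - (Q.card + l)) / S.card) *
      ((-1 : ℝ) ^ l * ((Q.card : ℝ) ^ l * f Q))) (x := S \ Q)
    simp only [F]
    rw [h2]
    set M := (S \ Q).card with hM
    have h3 := sum_bin2 M Q.card (-(Q.card : ℝ)) S.card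
    have h4 : -(Q.card : ℝ) + S.card = M := by
      have : (M : ℝ) + Q.card = S.card := by exact_mod_cast hc
      linarith
    rw [h4] at h3
    have h5 : ∑ m ∈ Finset.range (M + 1), M.choose m •
        (((Q.card : ℝ) + m) * (S.card : ℝ) ^ (S.card - (Q.card + m)) / S.card *
      ((-1 : ℝ) ^ m * ((Q.card : ℝ) ^ m * f Q))) = (f Q / S.card) *
      ∑ l ∈ Finset.range (M + 1), (M.choose l : ℝ) * ((-(Q.card : ℝ)) ^ l * (Q.card + (l : ℝ)) * (S.card : ℝ) ^ (M - l)) := by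
      rw [Finset.mul_sum]
      refine Finset.sum_congr rfl fun l hl => ?_
      rw [show S.card - (Q.card + l) = M - l by omega, nsmul_eq_mul, neg_pow (Q.card : ℝ)]
      ring
    rw [h5, h3]
    obtain ⟨M', hM'⟩ : ∃ M', M = M' + 1 := ⟨M - 1, by omega⟩
    rw [hM']
    simp only [Nat.add_sub_cancel]
    ring
  · intro h; exact absurd (Finset.mem_powerset.2 le_rfl) h

/-- explicit signed counts -/
noncomputable def ac (r y : ℕ) : ℝ :=
  if r ≤ y then (-1 / 2 : ℝ) ^ (y - r) * (r.choose (y - r)) * y.factorial / r.factorial else 0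

lemma ac_eq {V : Type} [Fintype V] (r : ℕ) (Y : Finset V) :
    ∑ J ∈ Y.powerset, (if J.card + 2 * r = 2 * Y.card then (-1 : ℝ) ^ (J.card / 2) * (RG 1 J).card
      else 0) = ac r Y.card := by
  classical
  have h1 : ∀ J ∈ Y.powerset,
    (if J.card + 2 * r = 2 * Y.card then (-1 : ℝ) ^ (J.card / 2) * (RG 1 J).card else 0)
     = (fun k : ℕ => if k + 2 * r = 2 * Y.card then (-1 : ℝ) ^ (k / 2) *
        (k.factorial / (2 ^ (k / 2) * (k / 2).factorial)) else 0) J.card := by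
    intro J _
    simp only
    split_ifs with h
    · have hev : J.card = 2 * (J.card / 2) := by omega
      have := RG1_card (J.card / 2) J hev
      rw [← hev] at this
      have h' : ((RG 1 J).card : ℝ) * (2 ^ (J.card / 2) * (J.card / 2).factorial) = J.card.factorial := by
        exact_mod_cast this
      rw [← (eq_div_iff (by positivity)).2 h']
    · rfl
  have h2 := Finset.sum_powerset_apply_card (fun k : ℕ => if k + 2 * r = 2 * Y.card then
    (-1 : ℝ) ^ (k / 2) * (k.factorial / (2 ^ (k / 2) * (k / 2).factorial)) else 0) (x := Y)
  rw [(Finset.sum_congr rfl h1).trans h2]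
  unfold ac
  split_ifs with hr
  · set y := Y.card
    obtain ⟨j, hj⟩ : ∃ j, y = r + j := ⟨y - r, by omega⟩
    by_cases hjr : j ≤ r
    · rw [Finset.sum_eq_single (2 * j)]
      · rw [if_pos (by omega), show 2 * j / 2 = j by omega, show y - r = j by omega, nsmul_eq_mul,
          Nat.cast_choose ℝ (show 2 * j ≤ y by omega), Nat.cast_choose ℝ hjr,
          show y - 2 * j = r - j by omega]
        have h1 : ((2 * j).factorial : ℝ) ≠ 0 := by positivity
        have h2 : ((r - j).factorial : ℝ) ≠ 0 := by positivity
        have h3 : (j.factorial : ℝ) ≠ 0 := by positivity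
        have h4 : (r.factorial : ℝ) ≠ 0 := by positivity
        rw [div_pow]
        field_simp
      · intro k _ hk
        rw [if_neg (by omega), smul_zero]
      · intro h; simp only [Finset.mem_range, not_lt] at h; omega
    · rw [Nat.choose_eq_zero_of_lt (show r < y - r by omega)]
      rw [Finset.sum_eq_zero]
      · simp
      · intro k hk
        rw [if_neg, smul_zero]
        simp only [Finset.mem_range] at hk
        omega
  · apply Finset.sum_eq_zero
    intro k _
    rw [if_neg (by omega), smul_zero]

/-- coefficients of `(1-t) e^{nt}` -/
noncomputable def bco (n q : ℕ) : ℝ := ((n : ℝ) - q) * (n : ℝ) ^ q / (n * q.factorial)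

/-- coefficients of `(1-t) e^{nt} (1-t/2)^r` -/
noncomputable def kap (n r p : ℕ) : ℝ :=
  ∑ j ∈ Finset.range (p + 1), ((r.choose j : ℝ) * (-1 / 2) ^ j) * bco n (p - j)

lemma K_eq (n r s : ℕ) (h : s + r ≤ n) :
    ∑ y ∈ Finset.range (n - s + 1), ((n - s).choose y : ℝ) *
      (((s : ℝ) + y) * (n : ℝ) ^ (n - (s + y)) / n * ac r y) =
      ((n - s).factorial / r.factorial) * kap n r (n - r - s) := by
  unfold kap
  rw [show n - s + 1 = r + (n - r - s + 1) by omega, Finset.sum_range_add, Finset.mul_sum]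
  rw [Finset.sum_eq_zero, zero_add]
  · refine Finset.sum_congr rfl fun j hj => ?_
    simp only [Finset.mem_range] at hj
    rw [ac, if_pos (by omega), bco, show r + j - r = j by omega,
      Nat.cast_choose ℝ (show r + j ≤ n - s by omega),
      show n - s - (r + j) = n - r - s - j by omega, show n - (s + (r + j)) = n - r - s - j by omega]
    have hcast : ((n - r - s - j : ℕ) : ℝ) = n - r - s - j := by
      rw [Nat.cast_sub (by omega), Nat.cast_sub (by omega), Nat.cast_sub (by omega)]
    rw [hcast]
    have h1 : ((r + j).factorial : ℝ) ≠ 0 := by positivity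
    push_cast
    field_simp
    ring
  · intro y hy
    simp only [Finset.mem_range] at hy
    rw [ac, if_neg (by omega)]; simp

lemma K_zero (n r s : ℕ) (hs : s ≤ n) (h : ¬ s + r ≤ n) :
    ∑ y ∈ Finset.range (n - s + 1), ((n - s).choose y : ℝ) *
      (((s : ℝ) + y) * (n : ℝ) ^ (n - (s + y)) / n * ac r y) = 0 := by
  apply Finset.sum_eq_zero
  intro y hy
  simp only [Finset.mem_range] at hy
  rw [ac, if_neg (by omega)]; simp

theorem PP_le (n r : ℕ) (hn : 0 < n) (hr : r ≤ n) :
    ((PP r (Finset.univ : Finset (Fin n))).card : ℝ) ≤ (n.factorial / r.factorial) *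
      ∑ s ∈ Finset.range (n - r + 1), (s.centralBinom / 4 ^ s : ℝ) * |kap n r (n - r - s)| := by
  classical
  have hcard : (Finset.univ : Finset (Fin n)).card = n := by simp
  have h1 := inversion (Finset.univ : Finset (Fin n)) (by simpa using hn) (fun S => ((PP r S).card : ℝ))
  simp only [altSum_eq, good_sum, ac_eq, hcard] at h1
  let F : Finset (Fin n) → Finset (Fin n) → ℝ := fun Z Y =>
    (RG 2 Z).card * ((((Z.card : ℝ) + Y.card) * (n : ℝ) ^ (n - (Z.card + Y.card)) / n) * ac r Y.card)
  have h2 : ∀ R ∈ (Finset.univ : Finset (Fin n)).powerset,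
      ((R.card : ℝ) * (n : ℝ) ^ (n - R.card) / n) *
      ∑ Z ∈ R.powerset, ((RG 2 Z).card : ℝ) * ac r (R \ Z).card = ∑ Z ∈ R.powerset, F Z (R \ Z) := by
    intro R _
    rw [Finset.mul_sum]
    refine Finset.sum_congr rfl fun L hL => ?_
    have : L.card + (R \ L).card = R.card := by
      rw [add_comm]; exact Finset.card_sdiff_add_card_eq_card (Finset.mem_powerset.1 hL)
    have h' : (L.card : ℝ) + (R \ L).card = R.card := by exact_mod_cast this
    simp only [F]
    rw [h', this]
    ring
  rw [Finset.sum_congr rfl h2, sum_split] at h1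
  let K : ℕ → ℝ := fun s => ∑ y ∈ Finset.range (n - s + 1), ((n - s).choose y : ℝ) *
      (((s : ℝ) + y) * (n : ℝ) ^ (n - (s + y)) / n * ac r y)
  have h3 : ∀ Z ∈ (Finset.univ : Finset (Fin n)).powerset,
      ∑ Y ∈ (Finset.univ \ Z).powerset, F Z Y = (RG 2 Z).card * K Z.card := by
    intro Z _
    simp only [F]
    rw [← Finset.mul_sum]
    congr 1
    have := Finset.sum_powerset_apply_card (fun y : ℕ =>
      (((Z.card : ℝ) + y) * (n : ℝ) ^ (n - (Z.card + y)) / n) * ac r y) (x := Finset.univ \ Z)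
    rw [this]
    have hZ : (Finset.univ \ Z).card = n - Z.card := by
      rw [Finset.card_sdiff_of_subset (Finset.subset_univ _), hcard]
    rw [hZ]
    simp only [K, nsmul_eq_mul]
  rw [Finset.sum_congr rfl h3] at h1
  rw [h1]
  let W : ℕ → ℝ := fun s => ((2 * s).factorial / (4 ^ s * s.factorial) : ℝ) * |K s|
  have h4 : ∀ Z ∈ (Finset.univ : Finset (Fin n)).powerset,
      ((RG 2 Z).card : ℝ) * K Z.card ≤ W Z.card := by
    intro Z _
    have hb : ((RG 2 Z).card : ℝ) * (4 ^ Z.card * Z.card.factorial) ≤ (2 * Z.card).factorial := by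
      exact_mod_cast RG2_bound Z
    have hb' : ((RG 2 Z).card : ℝ) ≤ (2 * Z.card).factorial / (4 ^ Z.card * Z.card.factorial) := by
      rw [le_div_iff₀ (by positivity)]; exact hb
    calc ((RG 2 Z).card : ℝ) * K Z.card ≤ ((RG 2 Z).card : ℝ) * |K Z.card| := by
          gcongr; exact le_abs_self _
      _ ≤ W Z.card := by
          simp only [W]; gcongr
  refine (Finset.sum_le_sum h4).trans ?_
  rw [Finset.sum_powerset_apply_card W, hcard, Finset.mul_sum]
  rw [← Finset.sum_subset (Finset.range_subset_range.2 (show n - r + 1 ≤ n + 1 by omega))]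
  · refine le_of_eq (Finset.sum_congr rfl fun s hs => ?_)
    simp only [Finset.mem_range] at hs
    have hKs : K s = ((n - s).factorial / r.factorial) * kap n r (n - r - s) := K_eq n r s (by omega)
    simp only [W]
    rw [hKs, abs_mul, abs_of_nonneg (by positivity : (0 : ℝ) ≤ ((n - s).factorial / r.factorial)),
      nsmul_eq_mul, Nat.cast_choose ℝ (show s ≤ n by omega), Nat.centralBinom,
      Nat.cast_choose ℝ (show s ≤ 2 * s by omega), show 2 * s - s = s by omega]
    have h1 : (s.factorial : ℝ) ≠ 0 := by positivity
    have h2 : ((n - s).factorial : ℝ) ≠ 0 := by positivity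
    field_simp
  · intro s hs hs'
    simp only [Finset.mem_range] at hs hs'
    have : K s = 0 := K_zero n r s (by omega) (by omega)
    simp [W, this]

/-- the generating function -/
noncomputable def gf (n r : ℕ) (t : ℂ) : ℂ := ((1 - t) * Complex.exp (n * t)) * (1 - t / 2) ^ r

lemma bco_succ (n q : ℕ) (hn : 0 < n) : bco n (q + 1) =
    (n : ℝ) ^ (q + 1) / (q + 1).factorial - (n : ℝ) ^ q / q.factorial := by
  unfold bco
  have : (n : ℝ) ≠ 0 := by positivity
  rw [Nat.factorial_succ]
  have h2 : (q.factorial : ℝ) ≠ 0 := by positivity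
  push_cast
  have h3 : (q : ℝ) + 1 ≠ 0 := by positivity
  field_simp
  ring

lemma bco_zero (n : ℕ) (hn : 0 < n) : bco n 0 = 1 := by
  unfold bco
  have : (n : ℝ) ≠ 0 := by positivity
  simp [this]

lemma exp_hasSum (n : ℕ) (t : ℂ) :
    HasSum (fun q : ℕ => (n : ℂ) ^ q / q.factorial * t ^ q) (Complex.exp (n * t)) := by
  have := NormedSpace.exp_series_hasSum_exp' (𝕂 := ℂ) ((n : ℂ) * t)
  rw [← Complex.exp_eq_exp_ℂ] at this
  have he : (fun q : ℕ => (n : ℂ) ^ q / q.factorial * t ^ q) =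
      fun q : ℕ => ((q.factorial : ℂ))⁻¹ • ((n : ℂ) * t) ^ q := by
    ext q
    rw [mul_pow, smul_eq_mul]; ring
  rw [he]
  exact this

lemma bco_hasSum (n : ℕ) (hn : 0 < n) (t : ℂ) :
    HasSum (fun q : ℕ => (bco n q : ℂ) * t ^ q) ((1 - t) * Complex.exp (n * t)) := by
  have h := exp_hasSum n t
  have h1 := h.mul_left t
  rw [← hasSum_nat_add_iff' 1] at h ⊢
  have h2 := h.sub h1
  simp only [Finset.sum_range_one, pow_zero, Nat.factorial_zero, Nat.cast_one, bco_zero n hn] at h2 ⊢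
  convert h2 using 1
  · ext q
    rw [bco_succ n q hn]
    push_cast
    ring
  · push_cast; ring

lemma binom_hasSum (r : ℕ) (t : ℂ) :
    HasSum (fun j : ℕ => (((r.choose j : ℝ) * (-1 / 2) ^ j : ℝ) : ℂ) * t ^ j) ((1 - t / 2) ^ r) := by
  have h : (1 - t / 2) ^ r = ∑ j ∈ Finset.range (r + 1), (((r.choose j : ℝ) * (-1 / 2) ^ j : ℝ) : ℂ) * t ^ j := by
    rw [sub_eq_neg_add, add_pow]
    refine Finset.sum_congr rfl fun j _ => ?_
    push_cast
    rw [show (-(t / 2)) = (-1 / 2) * t by ring, mul_pow]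
    simp
    ring
  rw [h]
  apply hasSum_sum_of_ne_finset_zero
  intro j hj
  simp only [Finset.mem_range, not_lt] at hj
  rw [Nat.choose_eq_zero_of_lt (by omega)]
  simp

lemma kap_hasSum (n r : ℕ) (hn : 0 < n) (t : ℂ) :
    HasSum (fun p : ℕ => (kap n r p : ℂ) * t ^ p) (gf n r t) := by
  have h1 := binom_hasSum r t
  have h2 := bco_hasSum n hn t
  have h := hasSum_sum_range_mul_of_summable_norm h1.summable.norm h2.summable.norm
  rw [h1.tsum_eq, h2.tsum_eq] at h
  unfold gf
  rw [mul_comm]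
  suffices he : (fun p : ℕ => (kap n r p : ℂ) * t ^ p) = fun p => ∑ k ∈ Finset.range (p + 1),
      ((((r.choose k : ℝ) * (-1 / 2) ^ k : ℝ) : ℂ) * t ^ k) * ((bco n (p - k) : ℂ) * t ^ (p - k)) by
    rw [he]; exact h
  ext p
  unfold kap
  push_cast
  rw [Finset.sum_mul]
  refine Finset.sum_congr rfl fun j hj => ?_
  simp only [Finset.mem_range] at hj
  rw [show t ^ p = t ^ j * t ^ (p - j) by rw [← pow_add]; congr 1; omega]
  ring

lemma gf_diff (n r : ℕ) : Differentiable ℂ (gf n r) := by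
  unfold gf
  fun_prop

lemma kap_le (n r p : ℕ) (hn : 0 < n) (ρ : ℝ) (hρ : 0 < ρ) :
    |kap n r p| ≤ ((2 * Real.pi)⁻¹ * ∫ θ in (0 : ℝ)..2 * Real.pi, ‖gf n r (circleMap 0 ρ θ)‖) * ρ⁻¹ ^ p := by
  have h1 : HasFPowerSeriesAt (gf n r) (FormalMultilinearSeries.ofScalars ℂ (fun p => (kap n r p : ℂ))) 0 := by
    rw [hasFPowerSeriesAt_iff]
    refine Eventually.of_forall fun t => ?_
    have := kap_hasSum n r hn t
    simp only [FormalMultilinearSeries.coeff_ofScalars, zero_add, smul_eq_mul]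
    simpa only [mul_comm] using this
  lift ρ to NNReal using hρ.le
  have h2 := ((gf_diff n r).differentiableOn (s := Metric.closedBall 0 ρ)).hasFPowerSeriesOnBall
    (by exact_mod_cast hρ)
  have h3 := h1.eq_formalMultilinearSeries h2.hasFPowerSeriesAt
  have h4 := norm_cauchyPowerSeries_le (gf n r) 0 ρ p
  rw [← h3] at h4
  have h5 := FormalMultilinearSeries.norm_apply_eq_norm_coef
    (p := FormalMultilinearSeries.ofScalars ℂ (fun p => (kap n r p : ℂ))) (n := p)
  rw [FormalMultilinearSeries.coeff_ofScalars, Complex.norm_real, Real.norm_eq_abs] at h5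
  rw [← h5]
  rw [abs_of_pos hρ] at h4
  exact h4

lemma gf_norm_le (n r : ℕ) (δ θ : ℝ) (h0 : 0 < δ) (h1 : δ ≤ 1 / 2) :
    ‖gf n r (circleMap 0 (1 - δ) θ)‖ ≤ (δ + |θ|) * (Real.exp (n * (1 - δ)) * ((1 + δ) / 2) ^ r *
      Real.exp (-((n - 2 * r / (1 + δ) ^ 2) * ((1 - δ) * (1 - Real.cos θ))))) := by
  set t := circleMap 0 (1 - δ) θ with ht
  have hre : t.re = (1 - δ) * Real.cos θ := by
    simp [ht, circleMap, Complex.exp_ofReal_mul_I_re]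
  have him : t.im = (1 - δ) * Real.sin θ := by
    simp [ht, circleMap, Complex.exp_ofReal_mul_I_im]
  set y := (1 - δ) * (1 - Real.cos θ) with hy
  have hy0 : 0 ≤ y := mul_nonneg (by linarith) (by linarith [Real.cos_le_one θ])
  have hA : ‖Complex.exp (n * t)‖ = Real.exp (n * (1 - δ)) * Real.exp (-(n * y)) := by
    rw [Complex.norm_exp, ← Real.exp_add]
    congr 1
    simp only [Complex.mul_re, Complex.natCast_re, Complex.natCast_im, hre, hy]
    ring
  have hB : ‖1 - t / 2‖ ≤ (1 + δ) / 2 * Real.exp (2 / (1 + δ) ^ 2 * y) := by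
    refine (sq_le_sq₀ (norm_nonneg _) (by positivity)).1 ?_
    rw [← Complex.normSq_eq_norm_sq, Complex.normSq_apply, mul_pow, ← Real.exp_nat_mul]
    have e1 : (1 - t / 2).re = 1 - (1 - δ) * Real.cos θ / 2 := by
      simp [hre]
    have e2 : (1 - t / 2).im = - ((1 - δ) * Real.sin θ / 2) := by
      simp [him]
    rw [e1, e2]
    have h3 := Real.add_one_le_exp ((2 : ℕ) * (2 / (1 + δ) ^ 2 * y))
    have h4 : ((1 + δ) / 2) ^ 2 * (((2 : ℕ) * (2 / (1 + δ) ^ 2 * y)) + 1) =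
      y + ((1 + δ) / 2) ^ 2 := by
      push_cast; field_simp
    have h5 := mul_le_mul_of_nonneg_left h3 (sq_nonneg ((1 + δ) / 2))
    rw [h4] at h5
    refine le_trans (le_of_eq ?_) h5
    have := Real.sin_sq_add_cos_sq θ
    rw [hy]
    linear_combination ((1 - δ) ^ 2 / 4) * this
  have hC : ‖1 - t‖ ≤ δ + |θ| := by
    have e : 1 - t = δ - (1 - δ) * (Complex.exp (Complex.I * θ) - 1) := by
      simp only [ht, circleMap]; push_cast; rw [mul_comm (θ : ℂ)]; ring
    rw [e]
    refine (norm_sub_le _ _).trans ?_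
    have h6 := Real.norm_exp_I_mul_ofReal_sub_one_le (x := θ)
    rw [norm_mul, Complex.norm_real, Real.norm_of_nonneg h0.le]
    have h7 : ‖(1 - δ : ℂ)‖ = 1 - δ := by
      rw [show (1 - δ : ℂ) = ((1 - δ : ℝ) : ℂ) by push_cast; rfl, Complex.norm_real, Real.norm_of_nonneg]
      linarith
    rw [h7]
    rw [Real.norm_eq_abs] at h6
    have : (1 - δ) * ‖Complex.exp (Complex.I * θ) - 1‖ ≤ 1 * |θ| := by
      gcongr; linarith
    linarith
  unfold gf
  rw [norm_mul, norm_mul, norm_pow, hA, mul_assoc]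
  refine mul_le_mul hC ?_ (by positivity) (by positivity)
  calc Real.exp (n * (1 - δ)) * Real.exp (-(n * y)) * ‖1 - t / 2‖ ^ r
      ≤ Real.exp (n * (1 - δ)) * Real.exp (-(n * y)) * ((1 + δ) / 2 * Real.exp (2 / (1 + δ) ^ 2 * y)) ^ r := by
        gcongr
    _ = _ := by
        rw [mul_pow, ← Real.exp_nat_mul, show -((n - 2 * r / (1 + δ) ^ 2) * y) =
          -(n * y) + r * (2 / (1 + δ) ^ 2 * y) by ring, Real.exp_add]
        ring

lemma gf_norm_le2 (n r : ℕ) (δ θ w : ℝ) (h0 : 0 < δ) (h1 : δ ≤ 1 / 2) (hw : 0 ≤ w)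
    (hwr : (n : ℝ) = 2 * r + w) (hb : 1 ≤ δ ^ 2 * (w + 2 * n * δ)) (hθ : |θ| ≤ Real.pi) :
    ‖gf n r (circleMap 0 (1 - δ) θ)‖ ≤ (Real.exp (n * (1 - δ)) * ((1 + δ) / 2) ^ r) *
      (11 * δ * Real.exp (-(1 / (80 * δ ^ 2)) * θ ^ 2)) := by
  refine (gf_norm_le n r δ θ h0 h1).trans ?_
  rw [mul_left_comm]
  apply mul_le_mul_of_nonneg_left _ (by positivity)
  have hE : 1 / (4 * δ ^ 2) ≤ n - 2 * r / (1 + δ) ^ 2 := by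
    have : (n - 2 * r / (1 + δ) ^ 2 : ℝ) = (n * (δ * (2 + δ)) + w) / (1 + δ) ^ 2 := by
      rw [eq_div_iff (by positivity), sub_mul, div_mul_cancel₀ _ (by positivity), hwr]; ring
    rw [this, div_le_div_iff₀ (by positivity) (by positivity)]
    have hn : (0 : ℝ) ≤ n := by positivity
    have : (1 + δ) ^ 2 ≤ 9 / 4 := by nlinarith
    have h5 : 0 ≤ n * δ ^ 2 := by positivity
    have : δ ^ 2 * (w + 2 * n * δ) ≤ δ ^ 2 * (n * (δ * (2 + δ)) + w) := by
      apply mul_le_mul_of_nonneg_left _ (sq_nonneg δ)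
      nlinarith
    nlinarith
  have hY : θ ^ 2 / 10 ≤ (1 - δ) * (1 - Real.cos θ) := by
    have h2 := Real.cos_le_one_sub_mul_cos_sq hθ
    have h3 : (1 : ℝ) / 10 ≤ 1 / Real.pi ^ 2 := by
      apply one_div_le_one_div_of_le (by positivity)
      nlinarith [Real.pi_lt_d2, Real.pi_pos]
    have h4 : 2 / Real.pi ^ 2 * θ ^ 2 = 2 * (1 / Real.pi ^ 2 * θ ^ 2) := by ring
    have h5 := mul_le_mul_of_nonneg_right h3 (sq_nonneg θ)
    have h6 : (1 / 2 : ℝ) * (1 - Real.cos θ) ≤ (1 - δ) * (1 - Real.cos θ) :=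
      mul_le_mul_of_nonneg_right (by linarith) (by linarith [Real.cos_le_one θ])
    linarith
  have hX : θ ^ 2 / (40 * δ ^ 2) ≤ (n - 2 * r / (1 + δ) ^ 2) * ((1 - δ) * (1 - Real.cos θ)) := by
    have := mul_le_mul hE hY (by positivity) (le_trans (by positivity) hE)
    refine le_trans (le_of_eq ?_) this
    field_simp; ring
  calc (δ + |θ|) * Real.exp (-((n - 2 * r / (1 + δ) ^ 2) * ((1 - δ) * (1 - Real.cos θ))))
      ≤ (δ + |θ|) * Real.exp (-(θ ^ 2 / (40 * δ ^ 2))) := by gcongr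
    _ = (δ + |θ|) * Real.exp (-(θ ^ 2 / (80 * δ ^ 2))) * Real.exp (-(1 / (80 * δ ^ 2)) * θ ^ 2) := by
        rw [mul_assoc, ← Real.exp_add]; congr 2; field_simp; ring
    _ ≤ _ := by
        apply mul_le_mul_of_nonneg_right _ (Real.exp_pos _).le
        rw [Real.exp_neg, ← div_eq_mul_inv, div_le_iff₀ (Real.exp_pos _)]
        have h3 := Real.add_one_le_exp (θ ^ 2 / (80 * δ ^ 2))
        refine le_trans ?_ (mul_le_mul_of_nonneg_left h3 (by positivity))
        have : 11 * δ * (θ ^ 2 / (80 * δ ^ 2) + 1) = (11 * θ ^ 2 / 80 + 11 * δ ^ 2) / δ := by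
          field_simp
        rw [this, le_div_iff₀ h0, ← sq_abs θ]
        nlinarith [sq_nonneg (11 * |θ| / 40 - δ), sq_nonneg (|θ| ), sq_nonneg δ]

lemma gf_int_le (n r : ℕ) (δ w : ℝ) (h0 : 0 < δ) (h1 : δ ≤ 1 / 2) (hw : 0 ≤ w)
    (hwr : (n : ℝ) = 2 * r + w) (hb : 1 ≤ δ ^ 2 * (w + 2 * n * δ)) :
    (2 * Real.pi)⁻¹ * ∫ θ in (0 : ℝ)..2 * Real.pi, ‖gf n r (circleMap 0 (1 - δ) θ)‖ ≤
      30 * δ ^ 2 * (Real.exp (n * (1 - δ)) * ((1 + δ) / 2) ^ r) := by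
  set B := Real.exp (n * (1 - δ)) * ((1 + δ) / 2) ^ r with hB
  have hB0 : 0 ≤ B := by positivity
  have hper : Function.Periodic (fun θ => ‖gf n r (circleMap 0 (1 - δ) θ)‖) (2 * Real.pi) := by
    intro θ
    simp only
    rw [periodic_circleMap 0 (1 - δ) θ]
  have e := hper.intervalIntegral_add_eq 0 (-Real.pi)
  rw [zero_add, show -Real.pi + 2 * Real.pi = Real.pi by ring] at e
  rw [e]
  have hc : Continuous (fun θ => ‖gf n r (circleMap 0 (1 - δ) θ)‖) :=
    ((gf_diff n r).continuous.comp (continuous_circleMap 0 _)).norm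
  have hpos : 0 < 1 / (80 * δ ^ 2) := by positivity
  have hgauss := integrable_exp_neg_mul_sq hpos
  have i1 : ∫ θ in (-Real.pi)..Real.pi, ‖gf n r (circleMap 0 (1 - δ) θ)‖ ≤
      ∫ θ in (-Real.pi)..Real.pi, B * (11 * δ * Real.exp (-(1 / (80 * δ ^ 2)) * θ ^ 2)) := by
    apply intervalIntegral.integral_mono_on (by linarith [Real.pi_pos])
    · exact hc.intervalIntegrable _ _
    · apply Continuous.intervalIntegrable; fun_prop
    · intro θ hθ
      exact gf_norm_le2 n r δ θ w h0 h1 hw hwr hb (abs_le.2 hθ)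
  have i2 : ∫ θ in (-Real.pi)..Real.pi, Real.exp (-(1 / (80 * δ ^ 2)) * θ ^ 2) ≤ 16 * δ := by
    rw [intervalIntegral.integral_of_le (by linarith [Real.pi_pos])]
    refine (MeasureTheory.setIntegral_le_integral hgauss (Eventually.of_forall fun x => (Real.exp_pos _).le)).trans ?_
    rw [integral_gaussian, Real.sqrt_le_left (by positivity)]
    rw [div_div_eq_mul_div, div_one]
    nlinarith [Real.pi_lt_d2, sq_nonneg δ]
  rw [intervalIntegral.integral_const_mul, intervalIntegral.integral_const_mul] at i1
  have i3 : B * (11 * δ * ∫ θ in (-Real.pi)..Real.pi, Real.exp (-(1 / (80 * δ ^ 2)) * θ ^ 2)) ≤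
      B * (11 * δ * (16 * δ)) := by gcongr
  have i4 := i1.trans i3
  rw [inv_mul_le_iff₀ (by positivity)]
  refine i4.trans ?_
  have : 0 ≤ B * δ ^ 2 := by positivity
  nlinarith [Real.pi_gt_three]

lemma cb_le (s : ℕ) : (s.centralBinom / 4 ^ s : ℝ) ≤ 1 / √((s : ℝ) + 1) := by
  have key : ((s.centralBinom / 4 ^ s : ℝ)) ^ 2 * (s + 1) ≤ 1 := by
    induction s with
    | zero => simp
    | succ s ih =>
      have h := Nat.succ_mul_centralBinom_succ s
      have h' : ((s : ℝ) + 1) * (s + 1).centralBinom = 2 * (2 * s + 1) * s.centralBinom := by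
        exact_mod_cast h
      have h2 : ((s + 1).centralBinom / 4 ^ (s + 1) : ℝ) =
          (2 * s + 1) / (2 * s + 2) * (s.centralBinom / 4 ^ s) := by
        rw [pow_succ]
        field_simp
        linear_combination 2 * h'
      rw [h2, mul_pow]
      set a := (s.centralBinom / 4 ^ s : ℝ)
      push_cast
      have h3 : ((2 * s + 1) / (2 * s + 2) : ℝ) ^ 2 * ((s : ℝ) + 1 + 1) ≤ s + 1 := by
        rw [div_pow, div_mul_eq_mul_div, div_le_iff₀ (by positivity)]
        have : (0 : ℝ) ≤ s := by positivity
        nlinarith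
      calc ((2 * s + 1) / (2 * s + 2) : ℝ) ^ 2 * a ^ 2 * ((s : ℝ) + 1 + 1)
          = (((2 * s + 1) / (2 * s + 2) : ℝ) ^ 2 * ((s : ℝ) + 1 + 1)) * a ^ 2 := by ring
        _ ≤ (s + 1) * a ^ 2 := by gcongr
        _ ≤ 1 := by linarith
  rw [le_div_iff₀ (by positivity)]
  refine (sq_le_sq₀ (by positivity) (by norm_num)).1 ?_
  rw [mul_pow, Real.sq_sqrt (by positivity)]
  simpa using key

lemma sum_ind (δ : ℝ) (h0 : 0 < δ) (M : ℕ) :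
    ∑ s ∈ Finset.range M, (if ((s : ℝ) + 1) * δ ≤ 1 then 1 / √((s : ℝ) + 1) else 0) ≤
      min (2 * √(M : ℝ)) (2 / √δ) := by
  induction M with
  | zero => simp; positivity
  | succ M ih =>
    rw [Finset.sum_range_succ]
    have hm : √(M : ℝ) ≤ √((M + 1 : ℕ) : ℝ) := Real.sqrt_le_sqrt (by push_cast; linarith)
    split_ifs with h
    · have h1 : 2 * √(M : ℝ) + 1 / √((M : ℝ) + 1) ≤ 2 * √((M : ℝ) + 1) := by
        have a0 := Real.sqrt_nonneg (M : ℝ)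
        have a1 : 0 < √((M : ℝ) + 1) := by positivity
        have a2 := Real.sq_sqrt (show (0 : ℝ) ≤ M by positivity)
        have a3 := Real.sq_sqrt (show (0 : ℝ) ≤ (M : ℝ) + 1 by positivity)
        have : 1 / √((M : ℝ) + 1) * √((M : ℝ) + 1) = 1 := by field_simp
        have : 1 / √((M : ℝ) + 1) ≤ 2 * (√((M : ℝ) + 1) - √(M : ℝ)) := by
          rw [div_le_iff₀ a1]
          nlinarith [sq_nonneg (√((M : ℝ) + 1) - √(M : ℝ))]
        linarith
      have h2 : √((M : ℝ) + 1) ≤ 1 / √δ := by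
        rw [le_div_iff₀ (by positivity), ← Real.sqrt_mul (by positivity)]
        exact Real.sqrt_le_one.2 h
      have h3 := ih.trans (min_le_left _ _)
      refine le_min ?_ ?_
      · push_cast; linarith
      · rw [show 2 / √δ = 2 * (1 / √δ) by ring]; linarith
    · rw [add_zero]
      refine le_min ((ih.trans (min_le_left _ _)).trans ?_) (ih.trans (min_le_right _ _))
      linarith

lemma cb_sum_le (δ : ℝ) (h0 : 0 < δ) (h1 : δ ≤ 1 / 2) (M : ℕ) :
    ∑ s ∈ Finset.range M, (s.centralBinom / 4 ^ s : ℝ) * (1 - δ) ^ s ≤ 3 / √δ := by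
  have hρ : 0 ≤ 1 - δ := by linarith
  have hρ1 : 1 - δ ≤ 1 := by linarith
  have hs : 0 < √δ := by positivity
  have step : ∀ s ∈ Finset.range M, (s.centralBinom / 4 ^ s : ℝ) * (1 - δ) ^ s ≤
      (if ((s : ℝ) + 1) * δ ≤ 1 then 1 / √((s : ℝ) + 1) else 0) + √δ * (1 - δ) ^ s := by
    intro s _
    have hp : (0 : ℝ) ≤ (1 - δ) ^ s := by positivity
    have hp1 : (1 - δ) ^ s ≤ 1 := pow_le_one₀ hρ hρ1
    have hc := cb_le s
    split_ifs with h
    · have : (s.centralBinom / 4 ^ s : ℝ) * (1 - δ) ^ s ≤ 1 / √((s : ℝ) + 1) * 1 := by gcongr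
      have : 0 ≤ √δ * (1 - δ) ^ s := by positivity
      linarith
    · rw [zero_add]
      gcongr
      refine hc.trans ?_
      rw [div_le_iff₀ (by positivity), ← Real.sqrt_mul (by positivity), Real.one_le_sqrt]
      rw [mul_comm]; linarith
  refine (Finset.sum_le_sum step).trans ?_
  rw [Finset.sum_add_distrib, ← Finset.mul_sum]
  have g := (sum_ind δ h0 M).trans (min_le_right _ _)
  have g2 : ∑ s ∈ Finset.range M, (1 - δ) ^ s ≤ 1 / δ := by
    rw [geom_sum_eq (by linarith), ← neg_div_neg_eq]
    have : 0 ≤ (1 - δ) ^ M := by positivity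
    rw [show -(1 - δ - 1) = δ by ring]
    gcongr; linarith
  have g3 : √δ * (1 / δ) = 1 / √δ := by
    rw [mul_one_div, div_eq_div_iff h0.ne' hs.ne', ← sq, Real.sq_sqrt h0.le, one_mul]
  have := mul_le_mul_of_nonneg_left g2 hs.le
  rw [g3] at this
  rw [show 3 / √δ = 2 / √δ + 1 / √δ by ring]
  linarith

lemma peak_le (n r m : ℕ) (δ w : ℝ) (h0 : 0 < δ) (h1 : δ ≤ 1 / 2) (hw : 0 ≤ w)
    (hwr : (n : ℝ) = 2 * r + w) (hm : m + r = n) (hd1 : w * δ ^ 2 ≤ 1) (hd2 : n * δ ^ 3 ≤ 1) :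
    Real.exp (n * (1 - δ)) * (1 + δ) ^ r * (1 - δ)⁻¹ ^ m ≤ Real.exp n * Real.exp (5 / 2) := by
  have hm' : (m : ℝ) = r + w := by
    have : (m : ℝ) + r = n := by exact_mod_cast hm
    linarith
  have hlt : 0 < 1 - δ := by linarith
  have a1 := Real.abs_log_sub_add_sum_range_le (x := δ) (by rw [abs_of_pos h0]; linarith) 2
  have a2 := Real.abs_log_sub_add_sum_range_le (x := -δ) (by rw [abs_neg, abs_of_pos h0]; linarith) 2
  rw [abs_neg] at a2
  rw [abs_of_pos h0] at a1 a2
  have a3 : δ ^ (2 + 1) / (1 - δ) ≤ 2 * δ ^ 3 := by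
    rw [div_le_iff₀ hlt]
    have : 0 ≤ δ ^ 3 := by positivity
    norm_num
    nlinarith
  rw [abs_le] at a1 a2
  simp only [Finset.sum_range_succ, Finset.sum_range_zero] at a1 a2
  have b1 : - Real.log (1 - δ) ≤ δ + δ ^ 2 / 2 + 2 * δ ^ 3 := by
    have := a1.1
    norm_num at this a3
    linarith
  have b2 : Real.log (1 + δ) ≤ δ - δ ^ 2 / 2 + 2 * δ ^ 3 := by
    have := a2.2
    norm_num at this a3
    linarith
  have e1 : (1 + δ) ^ r = Real.exp (r * Real.log (1 + δ)) := by
    rw [Real.exp_nat_mul, Real.exp_log (by linarith)]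
  have e2 : (1 - δ)⁻¹ ^ m = Real.exp (m * -Real.log (1 - δ)) := by
    rw [Real.exp_nat_mul, Real.exp_neg, Real.exp_log hlt]
  rw [e1, e2, ← Real.exp_add, ← Real.exp_add, ← Real.exp_add]
  apply Real.exp_le_exp.2
  have c1 := mul_le_mul_of_nonneg_left b1 (show (0 : ℝ) ≤ m by positivity)
  have c2 := mul_le_mul_of_nonneg_left b2 (show (0 : ℝ) ≤ r by positivity)
  rw [hm'] at c1 ⊢
  rw [hwr] at hd2 ⊢
  nlinarith

theorem PP_bound (n r m : ℕ) (hm : m + r = n) (hn : 8 ≤ n) (hmr : r < m) :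
    ((PP r (Finset.univ : Finset (Fin n))).card : ℝ) ≤
      (90 * Real.exp (5 / 2)) * (n.factorial / r.factorial * ((1 / 2) ^ r * Real.exp n)) / √n := by
  have hn0 : (0 : ℝ) < n := by have : 0 < n := by omega
                               exact_mod_cast this
  obtain ⟨k, hk⟩ : ∃ k, m = r + k := ⟨m - r, by omega⟩
  set w : ℝ := (k : ℝ) with hwdef
  have hk1 : (1 : ℝ) ≤ w := by
    rw [hwdef]; have : 1 ≤ k := by omega
    exact_mod_cast this
  have hwr : (n : ℝ) = 2 * r + w := by rw [hwdef]; rw [← hm, hk]; push_cast; ring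
  obtain ⟨δ, h0, h1, hb, hd1, hd2⟩ : ∃ δ : ℝ, 0 < δ ∧ δ ≤ 1 / 2 ∧ 1 ≤ δ ^ 2 * (w + 2 * n * δ) ∧
      w * δ ^ 2 ≤ 1 ∧ n * δ ^ 3 ≤ 1 := by
    set a : ℝ := (n : ℝ) ^ (-(1 / 3) : ℝ) with ha
    have ha0 : 0 < a := by positivity
    have ha3 : n * a ^ 3 = 1 := by
      rw [ha, ← Real.rpow_natCast, ← Real.rpow_mul hn0.le]
      norm_num
      rw [Real.rpow_neg_one]
      exact mul_inv_cancel₀ hn0.ne'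
    have ha2 : a ≤ 1 / 2 := by
      by_contra h
      push Not at h
      have h8 : (8 : ℝ) ≤ n := by exact_mod_cast hn
      have : (1 / 2) ^ 3 < a ^ 3 := by gcongr
      nlinarith
    set b : ℝ := 1 / √w with hb
    have hb0 : 0 < b := by positivity
    have hb2 : w * b ^ 2 = 1 := by
      rw [hb, div_pow, Real.sq_sqrt (by linarith)]; field_simp
    rcases le_total a b with h | h
    · refine ⟨a, ha0, ha2, ?_, ?_, ha3.le⟩
      · have : 0 ≤ a ^ 2 * w := by positivity
        nlinarith
      · rw [← hb2]; gcongr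
    · refine ⟨b, hb0, h.trans ha2, ?_, hb2.le, ?_⟩
      · have : 0 ≤ n * b ^ 3 := by positivity
        nlinarith
      · rw [← ha3]; gcongr
  have hlt : 0 < 1 - δ := by linarith
  have hw0 : 0 ≤ w := by linarith
  refine (PP_le n r (by omega) (by omega)).trans ?_
  have hnr : n - r = m := by omega
  rw [hnr]
  have hI := gf_int_le n r δ w h0 h1 hw0 hwr hb
  set B := Real.exp (n * (1 - δ)) * ((1 + δ) / 2) ^ r with hB
  have s1 : ∀ s ∈ Finset.range (m + 1), (s.centralBinom / 4 ^ s : ℝ) * |kap n r (m - s)| ≤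
      (30 * δ ^ 2 * (B * (1 - δ)⁻¹ ^ m)) * ((s.centralBinom / 4 ^ s : ℝ) * (1 - δ) ^ s) := by
    intro s hs
    simp only [Finset.mem_range] at hs
    have h2 := (kap_le n r (m - s) (by omega) (1 - δ) hlt).trans
      (mul_le_mul_of_nonneg_right hI (by positivity))
    have h3 : (1 - δ)⁻¹ ^ (m - s) = (1 - δ)⁻¹ ^ m * (1 - δ) ^ s := by
      obtain ⟨j, rfl⟩ : ∃ j, m = j + s := ⟨m - s, by omega⟩
      rw [Nat.add_sub_cancel, pow_add, mul_assoc, ← mul_pow, inv_mul_cancel₀ hlt.ne', one_pow, mul_one]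
    rw [h3] at h2
    calc (s.centralBinom / 4 ^ s : ℝ) * |kap n r (m - s)| ≤ (s.centralBinom / 4 ^ s : ℝ) * _ :=
          mul_le_mul_of_nonneg_left h2 (by positivity)
      _ = _ := by ring
  have s2 := Finset.sum_le_sum s1
  rw [← Finset.mul_sum] at s2
  have s3 := s2.trans (mul_le_mul_of_nonneg_left (cb_sum_le δ h0 h1 (m + 1)) (by positivity))
  have s4 := peak_le n r m δ w h0 h1 hw0 hwr hm hd1 hd2
  have s5 : B * (1 - δ)⁻¹ ^ m ≤ (1 / 2) ^ r * (Real.exp n * Real.exp (5 / 2)) := by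
    rw [hB, show (1 + δ) / 2 = (1 / 2) * (1 + δ) by ring, mul_pow]
    calc _ = (1 / 2) ^ r * (Real.exp (n * (1 - δ)) * (1 + δ) ^ r * (1 - δ)⁻¹ ^ m) := by ring
      _ ≤ _ := by gcongr
  have s6 : δ ^ 2 / √δ ≤ 1 / √n := by
    rw [div_le_div_iff₀ (by positivity) (by positivity), one_mul]
    refine (sq_le_sq₀ (by positivity) (by positivity)).1 ?_
    rw [mul_pow, Real.sq_sqrt hn0.le, Real.sq_sqrt h0.le]
    nlinarith
  calc _ ≤ (n.factorial / r.factorial : ℝ) * (30 * δ ^ 2 * (B * (1 - δ)⁻¹ ^ m) * (3 / √δ)) := by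
        gcongr
    _ = 90 * (n.factorial / r.factorial : ℝ) * (B * (1 - δ)⁻¹ ^ m) * (δ ^ 2 / √δ) := by ring
    _ ≤ 90 * (n.factorial / r.factorial : ℝ) * ((1 / 2) ^ r * (Real.exp n * Real.exp (5 / 2))) * (1 / √n) := by
        gcongr
    _ = _ := by ring

lemma e2_univ_eq {n : ℕ} (G : SimpleGraph (Fin n)) : e2 G Finset.univ = 2 * G.edgeSet.ncard := by
  classical
  have h := G.sum_degrees_eq_twice_card_edges
  rw [e2_univ, ← SimpleGraph.coe_edgeFinset, Set.ncard_coe_finset, ← h]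
  refine Finset.sum_congr rfl fun u _ => ?_
  rw [dg, ← SimpleGraph.card_neighborFinset_eq_degree, SimpleGraph.neighborFinset_eq_filter,
    Finset.card_filter]

lemma e2_set {n : ℕ} (G : SimpleGraph (Fin n)) (X : Finset (Fin n)) :
    e2 G X = 2 * {e : Sym2 (Fin n) | e ∈ G.edgeSet ∧ ∀ v ∈ e, v ∈ X}.ncard := by
  classical
  have h := e2_univ_eq (remV G (fun v => v ∉ X))
  have h1 : (remV G (fun v => v ∉ X)).edgeSet = {e : Sym2 (Fin n) | e ∈ G.edgeSet ∧ ∀ v ∈ e, v ∈ X} := by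
    ext e
    induction e with
    | h u v => simp [remV]
  rw [← h1, ← h]
  unfold e2
  have : ∀ u v, (if (remV G (fun v => v ∉ X)).Adj u v then 1 else 0) =
      if u ∈ X then (if v ∈ X then (if G.Adj u v then 1 else 0) else 0) else 0 := by
    intro u v
    by_cases h1 : u ∈ X <;> by_cases h2 : v ∈ X <;> simp [remV, h1, h2]
  simp only [this]
  rw [← Finset.sum_filter_add_sum_filter_not Finset.univ (fun u => u ∈ X)]
  rw [Finset.sum_filter, Finset.sum_filter]
  simp [Finset.sum_ite_mem]
  exact fun i h1 h2 => absurd h2 h1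

lemma closed_reach {V : Type} (G : SimpleGraph V) (X : Finset V)
    (hX : ∀ u v, G.Adj u v → u ∈ X → v ∈ X) {u v : V} (h : G.Reachable u v) (hu : u ∈ X) : v ∈ X := by
  obtain ⟨p⟩ := h
  induction p with
  | nil => exact hu
  | cons h p ih => exact ih (hX _ _ h hu)

lemma closed_sparse {n : ℕ} (G : SimpleGraph (Fin n)) (hG : NonComplex G) (k : ℕ) :
    ∀ X : Finset (Fin n), X.card = k → (∀ u v, G.Adj u v → u ∈ X → v ∈ X) → e2 G X ≤ 2 * X.card := by
  classical
  induction k using Nat.strong_induction_on with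
  | _ k ih =>
    intro X hk hX
    rcases X.eq_empty_or_nonempty with rfl | ⟨u, hu⟩
    · simp [e2]
    · set c := G.connectedComponentMk u with hc
      set C : Finset (Fin n) := c.supp.toFinset with hC
      have hmem : ∀ v, v ∈ C ↔ G.Reachable v u := by
        intro v
        rw [hC, Set.mem_toFinset, SimpleGraph.ConnectedComponent.mem_supp_iff, hc,
          SimpleGraph.ConnectedComponent.eq]
      have hCX : C ⊆ X := by
        intro v hv
        exact closed_reach G X hX ((hmem v).1 hv).symm hu
      have huC : u ∈ C := (hmem u).2 (SimpleGraph.Reachable.refl _)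
      have hCc : ∀ a b, G.Adj a b → (a ∈ C ↔ b ∈ C) := by
        intro a b hab
        rw [hmem, hmem]
        exact ⟨fun h => hab.symm.reachable.trans h, fun h => hab.reachable.trans h⟩
      have hsum : C.card + (X \ C).card = X.card := by
        rw [add_comm]; exact Finset.card_sdiff_add_card_eq_card hCX
      have hCpos : 0 < C.card := Finset.card_pos.2 ⟨u, huC⟩
      have h1 := ih (X \ C).card (by omega) (X \ C) rfl (by
        intro a b hab ha
        rw [Finset.mem_sdiff] at ha ⊢
        exact ⟨hX a b hab ha.1, fun h => ha.2 ((hCc a b hab).2 h)⟩)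
      have h2 : e2 G C ≤ 2 * C.card := by
        rw [e2_set]
        have := hG c
        have e : c.supp.ncard = C.card := by rw [hC, Set.ncard_eq_toFinset_card']
        rw [e] at this
        have e3 : {e : Sym2 (Fin n) | e ∈ G.edgeSet ∧ ∀ v ∈ e, v ∈ C} =
          {e : Sym2 (Fin n) | e ∈ G.edgeSet ∧ ∀ v ∈ e, v ∈ c.supp} := by
          simp [hC]
        rw [e3]
        omega
      have h3 : e2 G X = e2 G C + e2 G (X \ C) := by
        have hdis : Disjoint C (X \ C) := Finset.disjoint_sdiff
        have hX' : X = C ∪ (X \ C) := (Finset.union_sdiff_of_subset hCX).symm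
        unfold e2
        conv_lhs => rw [hX']
        rw [Finset.sum_union hdis]
        congr 1
        · refine Finset.sum_congr rfl fun a ha => ?_
          rw [Finset.sum_union hdis, Finset.sum_eq_zero (s := X \ C), add_zero]
          intro b hb
          rw [if_neg]
          intro hab
          exact (Finset.mem_sdiff.1 hb).2 ((hCc a b hab).1 ha)
        · refine Finset.sum_congr rfl fun a ha => ?_
          rw [Finset.sum_union hdis, Finset.sum_eq_zero (s := C), zero_add]
          intro b hb
          rw [if_neg]
          intro hab
          exact (Finset.mem_sdiff.1 ha).2 ((hCc a b hab).2 hb)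
      omega

lemma sparse_of_nonComplex {n : ℕ} (G : SimpleGraph (Fin n)) (hG : NonComplex G) (k : ℕ) :
    ∀ X : Finset (Fin n), X.card + k = n → e2 G X ≤ 2 * X.card := by
  classical
  induction k with
  | zero =>
    intro X hX
    have : X = Finset.univ := by
      apply Finset.eq_univ_of_card; simpa using hX
    subst this
    exact closed_sparse G hG _ _ rfl (fun _ _ _ _ => Finset.mem_univ _)
  | succ k ih =>
    intro X hX
    by_cases h : ∀ u v, G.Adj u v → u ∈ X → v ∈ X
    · exact closed_sparse G hG _ X rfl h
    · push Not at h
      obtain ⟨u, v, huv, hu, hv⟩ := h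
      have h1 := ih (insert v X) (by rw [Finset.card_insert_of_notMem hv]; omega)
      rw [Finset.card_insert_of_notMem hv] at h1
      have h2 : e2 G X + 2 ≤ e2 G (insert v X) := by
        unfold e2
        rw [Finset.sum_insert hv]
        simp only [Finset.sum_insert hv]
        rw [Finset.sum_add_distrib]
        have a1 : 1 ≤ ∑ x ∈ X, if G.Adj v x then 1 else 0 := by
          refine le_trans ?_ (Finset.single_le_sum (fun _ _ => Nat.zero_le _) hu)
          rw [if_pos huv.symm]
        have a2 : 1 ≤ ∑ x ∈ X, if G.Adj x v then 1 else 0 := by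
          refine le_trans ?_ (Finset.single_le_sum (fun _ _ => Nat.zero_le _) hu)
          rw [if_pos huv]
        omega
      omega

lemma Ucard_le (n m r : ℕ) (h : m + r = n) :
    Ucard n m ≤ (PP r (Finset.univ : Finset (Fin n))).card := by
  classical
  unfold Ucard
  rw [Nat.card_eq_fintype_card, Fintype.card_subtype]
  apply Finset.card_le_card
  intro G hG
  simp only [Finset.mem_filter, Finset.mem_univ, true_and] at hG
  unfold PP
  simp only [Finset.mem_filter, Finset.mem_univ, true_and, implies_true]
  refine ⟨fun X => ?_, ?_⟩
  · have : X.card ≤ n := by simpa using Finset.card_le_univ X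
    exact sparse_of_nonComplex G hG.2 (n - X.card) X (by omega)
  · rw [e2_univ_eq, hG.1]; simp; omega

lemma fact_le (n : ℕ) (hn : 0 < n) : (n.factorial : ℝ) ≤ Real.exp 1 * √n * (n / Real.exp 1) ^ n := by
  obtain ⟨k, rfl⟩ : ∃ k, n = k + 1 := ⟨n - 1, by omega⟩
  have h := Stirling.stirlingSeq'_antitone (Nat.zero_le k)
  simp only [Function.comp, Nat.succ_eq_add_one, zero_add, Stirling.stirlingSeq_one] at h
  rw [Stirling.stirlingSeq, div_le_iff₀ (by positivity)] at h
  refine h.trans (le_of_eq ?_)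
  rw [Real.sqrt_mul (by norm_num)]
  have : √(2 : ℝ) ≠ 0 := by positivity
  field_simp

lemma le_fact (n : ℕ) : √n * (n / Real.exp 1) ^ n ≤ (n.factorial : ℝ) := by
  refine le_trans ?_ (Stirling.le_factorial_stirling n)
  gcongr
  have : (0 : ℝ) ≤ n := by positivity
  nlinarith [Real.pi_gt_three]

lemma choose_ge (n m : ℕ) (hn : 6 ≤ n) (hm : m ≤ n) :
    Real.exp (-6) * ((n : ℝ) ^ (2 * m) / 2 ^ m / m.factorial) ≤ ((n.choose 2).choose m : ℝ) := by
  have hn' : (6 : ℝ) ≤ n := by exact_mod_cast hn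
  have hn0 : (0 : ℝ) < n := by linarith
  have hm' : (m : ℝ) ≤ n := by exact_mod_cast hm
  have hN : ((n.choose 2 : ℕ) : ℝ) = n * (n - 1) / 2 := Nat.cast_choose_two ℝ n
  have hmN : m ≤ n.choose 2 := by
    have : (m : ℝ) ≤ (n.choose 2 : ℕ) := by rw [hN]; nlinarith
    exact_mod_cast this
  have h1 : ((n.choose 2 + 1 - m : ℕ) : ℝ) ^ m / m.factorial ≤ ((n.choose 2).choose m : ℝ) :=
    Nat.pow_le_choose m (n.choose 2)
  refine le_trans ?_ h1
  rw [← mul_div_assoc]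
  gcongr
  have hx : (3 : ℝ) / n ≤ 1 / 2 := by rw [div_le_div_iff₀ hn0 (by norm_num)]; linarith
  have hx0 : 0 ≤ (3 : ℝ) / n := by positivity
  have h2 : Real.exp (-(2 * (3 / n))) ≤ 1 - 3 / (n : ℝ) := by
    have hp : 0 < 1 - 3 / (n : ℝ) := by linarith
    rw [← Real.le_log_iff_exp_le hp]
    refine le_trans ?_ (Real.one_sub_inv_le_log_of_pos hp)
    have : (1 - 3 / (n : ℝ))⁻¹ ≤ 1 + 2 * (3 / n) := by
      rw [inv_le_iff_one_le_mul₀ hp]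
      nlinarith
    linarith
  have h3 : Real.exp (-6) ≤ (1 - 3 / (n : ℝ)) ^ m := by
    refine le_trans ?_ (pow_le_pow_left₀ (Real.exp_pos _).le h2 m)
    rw [← Real.exp_nat_mul]
    apply Real.exp_le_exp.2
    have : (m : ℝ) * -(2 * (3 / n)) = -6 * (m / n) := by ring
    rw [this]
    have : (m : ℝ) / n ≤ 1 := (div_le_one hn0).2 hm'
    linarith
  calc Real.exp (-6) * ((n : ℝ) ^ (2 * m) / 2 ^ m) ≤
      (1 - 3 / (n : ℝ)) ^ m * ((n : ℝ) ^ (2 * m) / 2 ^ m) := by gcongr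
    _ = ((1 - 3 / (n : ℝ)) * ((n : ℝ) ^ 2 / 2)) ^ m := by
      rw [mul_pow, div_pow ((n : ℝ) ^ 2), ← pow_mul]
    _ ≤ _ := by
      have hp : 0 ≤ 1 - 3 / (n : ℝ) := by linarith
      gcongr
      rw [Nat.cast_sub (by omega)]
      push_cast
      rw [hN]
      have : (1 - 3 / (n : ℝ)) * ((n : ℝ) ^ 2 / 2) = (n ^ 2 - 3 * n) / 2 := by
        field_simp
      rw [this]
      nlinarith

lemma final_bound (n m r k : ℕ) (hn : 8 ≤ n) (hr : 0 < r) (hk : 0 < k) (hm : m = r + k) (hmn : m + r = n) :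
    (Ucard n m : ℝ) ≤ (90 * Real.exp (5 / 2) * Real.exp 1 ^ 2 * Real.exp 6) * (1 / √n) *
      (2 / Real.exp 1) ^ k * ((m : ℝ) ^ m * √m) * (((n : ℝ) ^ k)⁻¹ * √n) * (((r : ℝ) ^ r * √r)⁻¹) *
      ((n.choose 2).choose m : ℝ) := by
  have hn0 : (0 : ℝ) < n := by have : 0 < n := by omega
                               exact_mod_cast this
  have hm0 : (0 : ℝ) < m := by have : 0 < m := by omega
                               exact_mod_cast this
  have hr0 : (0 : ℝ) < r := by exact_mod_cast hr
  have hU : (Ucard n m : ℝ) ≤ (PP r (Finset.univ : Finset (Fin n))).card := by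
    exact_mod_cast Ucard_le n m r hmn
  have h1 := hU.trans (PP_bound n r m hmn hn (by omega))
  have h2 := fact_le n (by omega)
  have h3 := le_fact r
  have h4 := choose_ge n m (by omega) (by omega)
  have h5 := fact_le m (by omega)
  set E := Real.exp 1 with hE
  have hE0 : 0 < E := Real.exp_pos _
  have hEn : Real.exp n = E ^ n := by rw [hE, ← Real.exp_nat_mul, mul_one]
  have h6 : (n.factorial : ℝ) / r.factorial ≤ (E * √n * (n / E) ^ n) / (√r * (r / E) ^ r) := by
    gcongr
  have h7 : Real.exp (-6) * ((n : ℝ) ^ (2 * m) / 2 ^ m / (E * √m * (m / E) ^ m)) ≤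
      ((n.choose 2).choose m : ℝ) := by
    refine le_trans ?_ h4
    gcongr
  set A := 90 * Real.exp (5 / 2) with hA
  have hA0 : 0 < A := by positivity
  calc (Ucard n m : ℝ) ≤ A * (n.factorial / r.factorial * ((1 / 2) ^ r * Real.exp n)) / √n := h1
    _ ≤ A * ((E * √n * (n / E) ^ n) / (√r * (r / E) ^ r) * ((1 / 2) ^ r * Real.exp n)) / √n := by
        gcongr
    _ = (A * E ^ 2 * Real.exp 6) * (1 / √n) *
      (2 / E) ^ k * ((m : ℝ) ^ m * √m) * (((n : ℝ) ^ k)⁻¹ * √n) * (((r : ℝ) ^ r * √r)⁻¹) *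
      (Real.exp (-6) * ((n : ℝ) ^ (2 * m) / 2 ^ m / (E * √m * (m / E) ^ m))) := by
        rw [hEn, Real.exp_neg]
        have e1 : (n : ℝ) ^ (2 * m) = n ^ n * n ^ k := by rw [← pow_add]; congr 1; omega
        have e2 : (2 : ℝ) ^ m = 2 ^ r * 2 ^ k := by rw [hm, pow_add]
        have e3 : E ^ m = E ^ r * E ^ k := by rw [hm, pow_add]
        simp only [div_pow, one_pow]
        rw [e1, e2, e3]
        have : Real.exp 6 ≠ 0 := (Real.exp_pos _).ne'
        have : √(n : ℝ) ≠ 0 := by positivity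
        have : √(m : ℝ) ≠ 0 := by positivity
        have : √(r : ℝ) ≠ 0 := by positivity
        field_simp
    _ ≤ _ := by
        gcongr

theorem stmt2 :
    ∃ c : ℝ, 0 < c ∧ ∀ m : ℕ → ℕ,
      (∀ n : ℕ, 0 < (2 * m n : ℝ) - n) →
      Tendsto
        (fun n : ℕ => (((2 * m n : ℝ) - n) / (n : ℝ) ^ ((2 : ℝ) / 3)) / (n : ℝ) ^ ((1 : ℝ) / 12))
        atTop (nhds 0) →
      ∀ᶠ n : ℕ in atTop,
        (Ucard n (m n) : ℝ) ≤
          c * (n : ℝ) ^ (-(1 : ℝ) / 2) * (2 / Real.exp 1) ^ ((2 * m n : ℝ) - n)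
            * (m n : ℝ) ^ ((m n : ℝ) + 1 / 2) * (n : ℝ) ^ ((n : ℝ) - 2 * m n + 1 / 2)
            * ((n : ℝ) - m n) ^ (-((n : ℝ) - m n + 1 / 2))
            * ((n.choose 2).choose (m n) : ℝ) := by
  refine ⟨90 * Real.exp (5 / 2) * Real.exp 1 ^ 2 * Real.exp 6, by positivity, ?_⟩
  intro m hpos hlim
  have hev := hlim.eventually (gt_mem_nhds (show (0 : ℝ) < 1 by norm_num))
  filter_upwards [hev, eventually_ge_atTop 8] with n hn hn8
  have hn0 : (0 : ℝ) < n := by have : 0 < n := by omega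
                               exact_mod_cast this
  have hn1 : (1 : ℝ) ≤ n := by have : 1 ≤ n := by omega
                               exact_mod_cast this
  have hlt : (2 * m n : ℝ) - n < n := by
    rw [div_div, div_lt_one (by positivity), ← Real.rpow_add hn0] at hn
    refine hn.trans_le ?_
    calc (n : ℝ) ^ ((2 : ℝ) / 3 + 1 / 12) ≤ (n : ℝ) ^ (1 : ℝ) := by
          apply Real.rpow_le_rpow_of_exponent_le hn1; norm_num
      _ = n := Real.rpow_one _
  have hgt := hpos n
  have hlt' : m n < n := by
    have : (m n : ℝ) < n := by linarith
    exact_mod_cast this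
  have hgt' : n < 2 * m n := by
    have : (n : ℝ) < 2 * m n := by linarith
    exact_mod_cast this
  obtain ⟨r, hr⟩ : ∃ r, m n + r = n := ⟨n - m n, by omega⟩
  obtain ⟨k, hk⟩ : ∃ k, m n = r + k := ⟨m n - r, by omega⟩
  have key := final_bound n (m n) r k hn8 (by omega) (by omega) hk hr
  generalize m n = M at *
  have hrR : (n : ℝ) - M = r := by rw [← hr]; push_cast; ring
  have hkR : (2 * M : ℝ) - n = k := by rw [← hr, hk]; push_cast; ring
  have hkR' : (n : ℝ) - 2 * M + 1 / 2 = -(k : ℝ) + 1 / 2 := by linarith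
  have hM0 : (0 : ℝ) < M := by have : 0 < M := by omega
                               exact_mod_cast this
  have hr0 : (0 : ℝ) < r := by have : 0 < r := by omega
                               exact_mod_cast this
  rw [hrR, hkR, hkR', Real.rpow_natCast, Real.rpow_add hM0, Real.rpow_natCast, Real.rpow_add hn0,
    Real.rpow_neg hn0.le, Real.rpow_natCast, Real.rpow_neg hr0.le, Real.rpow_add hr0, Real.rpow_natCast,
    neg_div, Real.rpow_neg hn0.le, ← Real.sqrt_eq_rpow, ← Real.sqrt_eq_rpow, ← Real.sqrt_eq_rpow,
    ← one_div (√(n : ℝ))]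
  exact key
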